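/- Energy inequality for the rescaled solution: let m ∈ (m_s, 1), let u be a radial energy solution of the fast diffusion equation with exponent m and extinction time T > 0, and let w be its rescaled solution. Then for every τ > 0, ∫_0^∞ [ ½ (∂_r(w^m)(s,τ))² − (m/((1−m²)T)) w(s,τ)^{m+1} ] (sinh s)^{N−1} ds + m ∫_0^τ ∫_0^∞ w(s,σ)^{m−1} (∂_τ w(s,σ))² (sinh s)^{N−1} ds dσ ≤ ∫_0^∞ [ ½ ((u_0^m)′(s))² − (m/((1−m²)T)) u_0(s)^{m+1} ] (sinh s)^{N−1} ds. -/

import Mathlib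

open MeasureTheory Set Filter Topology

/-- Membership in the radial energy space `H¹_rad` on hyperbolic space `ℍ^N`:
`v` is locally absolutely continuous on `(0,∞)` (expressed via the fundamental theorem
of calculus for its a.e. derivative) and both `v` and `v'` are square-integrable with
respect to the weight `(sinh s)^(N-1)`. -/
def MemH1rad (N : ℕ) (v : ℝ → ℝ) : Prop :=
  (∀ a b : ℝ, 0 < a → a ≤ b → v b - v a = ∫ s in a..b, deriv v s) ∧
  MeasureTheory.IntegrableOn (fun s => (v s) ^ 2 * Real.sinh s ^ (N - 1)) (Set.Ioi 0) ∧
  MeasureTheory.IntegrableOn (fun s => (deriv v s) ^ 2 * Real.sinh s ^ (N - 1)) (Set.Ioi 0)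

/-- The squared `H¹` norm `‖v‖_2² + ‖v'‖_2²` with weight `(sinh s)^(N-1)`. -/
noncomputable def H1normSq (N : ℕ) (v : ℝ → ℝ) : ℝ :=
  (∫ s in Set.Ioi (0:ℝ), (v s) ^ 2 * Real.sinh s ^ (N - 1)) +
  (∫ s in Set.Ioi (0:ℝ), (deriv v s) ^ 2 * Real.sinh s ^ (N - 1))

/-- A radial energy solution of the fast diffusion equation `u_t = Δ(u^m)` on `ℍ^N`,
with exponent `m`, extinction time `T` (initial datum `u(·,0)`). -/
structure IsRadialEnergySolution (N : ℕ) (m T : ℝ) (u : ℝ → ℝ → ℝ) : Prop where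
  continuousOn : ContinuousOn (fun p : ℝ × ℝ => u p.1 p.2) (Set.Ici 0 ×ˢ Set.Icc 0 T)
  nonneg : ∀ r ∈ Set.Ici (0:ℝ), ∀ t ∈ Set.Icc (0:ℝ) T, 0 ≤ u r t
  smooth : ContDiffOn ℝ (⊤ : ℕ∞) (fun p : ℝ × ℝ => u p.1 p.2) (Set.Ici 0 ×ˢ Set.Ioo 0 T)
  pos : ∀ r ∈ Set.Ici (0:ℝ), ∀ t ∈ Set.Ioo (0:ℝ) T, 0 < u r t
  pde : ∀ r > (0:ℝ), ∀ t ∈ Set.Ioo (0:ℝ) T,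
    deriv (fun τ => u r τ) t
      = deriv (deriv (fun ρ => u ρ t ^ m)) r
        + ((N : ℝ) - 1) * (Real.cosh r / Real.sinh r) * deriv (fun ρ => u ρ t ^ m) r
  neumann : ∀ t ∈ Set.Ioo (0:ℝ) T, deriv (fun ρ => u ρ t ^ m) 0 = 0
  extinction : ∀ r ∈ Set.Ici (0:ℝ), u r T = 0
  energy : ∀ t ∈ Set.Ioo (0:ℝ) T, MemH1rad N (fun ρ => u ρ t ^ m)
  energy_bdd : ∀ ε ∈ Set.Ioo (0:ℝ) T, ∃ C : ℝ, ∀ t ∈ Set.Ico ε T,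
    H1normSq N (fun ρ => u ρ t ^ m) ≤ C
  init_bdd : ∃ M : ℝ, ∀ r ∈ Set.Ici (0:ℝ), u r 0 ≤ M
  init_nonzero : ∃ r ∈ Set.Ici (0:ℝ), u r 0 ≠ 0
  init_energy : MemH1rad N (fun ρ => u ρ 0 ^ m)

/-- The rescaled solution `w(r,τ) = e^{τ/((1-m)T)} u(r, T - T e^{-τ/T})`. -/
noncomputable def rescaled (m T : ℝ) (u : ℝ → ℝ → ℝ) (r τ : ℝ) : ℝ :=
  Real.exp (τ / ((1 - m) * T)) * u r (T - T * Real.exp (-τ / T))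

/-- weight -/
noncomputable def Sw (N : ℕ) (r : ℝ) : ℝ := Real.sinh r ^ (N - 1)

/-- working package for a solution -/
structure Sol (N : ℕ) (m T : ℝ) (u v vr ut : ℝ → ℝ → ℝ) : Prop where
  hN : 2 ≤ N
  m0 : 0 < m
  m1 : m < 1
  T0 : 0 < T
  cu : Continuous (fun p : ℝ × ℝ => u p.1 p.2)
  cv : Continuous (fun p : ℝ × ℝ => v p.1 p.2)
  un : ∀ r t, 0 ≤ u r t
  veq : ∀ r t, v r t = u r t ^ m
  pos : ∀ r, 0 ≤ r → ∀ t ∈ Ioo 0 T, 0 < u r t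
  cvr : ContinuousOn (fun p : ℝ × ℝ => vr p.1 p.2) (Ici 0 ×ˢ Ioo 0 T)
  cut : ContinuousOn (fun p : ℝ × ℝ => ut p.1 p.2) (Ici 0 ×ˢ Ioo 0 T)
  dv : ∀ r, 0 < r → ∀ t ∈ Ioo 0 T, HasDerivAt (fun ρ => v ρ t) (vr r t) r
  du : ∀ r, 0 ≤ r → ∀ t ∈ Ioo 0 T, HasDerivAt (fun t => u r t) (ut r t) t
  dflux : ∀ r, 0 < r → ∀ t ∈ Ioo 0 T,
    HasDerivAt (fun ρ => Sw N ρ * vr ρ t) (Sw N r * ut r t) r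
  h1 : ∀ a ∈ Ico 0 T, MemH1rad N (fun ρ => v ρ a)
  mesut : Measurable (fun p : ℝ × ℝ => ut p.1 p.2)

lemma Sw_cont (N : ℕ) : Continuous (Sw N) := by unfold Sw; fun_prop
lemma Sw_pos (N : ℕ) {r : ℝ} (hr : 0 < r) : 0 < Sw N r := by
  unfold Sw; exact pow_pos (Real.sinh_pos_iff.2 hr) _
lemma Sw_nonneg (N : ℕ) {r : ℝ} (hr : 0 ≤ r) : 0 ≤ Sw N r := by
  unfold Sw; exact pow_nonneg (Real.sinh_nonneg_iff.2 hr) _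
lemma Sw_zero {N : ℕ} (hN : 2 ≤ N) : Sw N 0 = 0 := by
  unfold Sw; rw [Real.sinh_zero]; exact zero_pow (by omega)
lemma Sw_mono (N : ℕ) {a b : ℝ} (ha : 0 ≤ a) (hab : a ≤ b) : Sw N a ≤ Sw N b := by
  unfold Sw
  exact pow_le_pow_left₀ (Real.sinh_nonneg_iff.2 ha) (Real.sinh_le_sinh.2 hab) _
lemma Sw_deriv {N : ℕ} (hN : 2 ≤ N) (r : ℝ) :
    HasDerivAt (Sw N) (((N:ℝ) - 1) * Real.sinh r ^ (N - 2) * Real.cosh r) r := by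
  unfold Sw
  have := (Real.hasDerivAt_sinh r).pow (N - 1)
  have h2 : ((N - 1 : ℕ) : ℝ) = (N:ℝ) - 1 := by
    rw [Nat.cast_sub (by omega)]; simp
  rw [h2] at this
  have h3 : N - 1 - 1 = N - 2 := by omega
  rw [h3] at this
  exact this

namespace Sol
variable {N : ℕ} {m T : ℝ} {u v vr ut : ℝ → ℝ → ℝ}

lemma dvt (h : Sol N m T u v vr ut) {r t : ℝ} (hr : 0 ≤ r) (ht : t ∈ Ioo 0 T) :
    HasDerivAt (fun t => v r t) (m * u r t ^ (m - 1) * ut r t) t := by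
  have := (h.du r hr t ht).rpow_const (p := m) (Or.inl (h.pos r hr t ht).ne')
  have e : (fun t => v r t) = fun t => u r t ^ m := by funext t; exact h.veq r t
  rw [e]; convert this using 1; ring

lemma cvr_r (h : Sol N m T u v vr ut) {t : ℝ} (ht : t ∈ Ioo 0 T) :
    ContinuousOn (fun r => vr r t) (Ici 0) :=
  h.cvr.comp (f := fun r : ℝ => ((r, t) : ℝ × ℝ)) (by fun_prop) (fun r hr => ⟨hr, ht⟩)

lemma cut_r (h : Sol N m T u v vr ut) {t : ℝ} (ht : t ∈ Ioo 0 T) :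
    ContinuousOn (fun r => ut r t) (Ici 0) :=
  h.cut.comp (f := fun r : ℝ => ((r, t) : ℝ × ℝ)) (by fun_prop) (fun r hr => ⟨hr, ht⟩)

lemma cv_r (h : Sol N m T u v vr ut) (t : ℝ) : Continuous (fun r => v r t) :=
  h.cv.comp (f := fun r : ℝ => ((r, t) : ℝ × ℝ)) (by fun_prop)
lemma cu_r (h : Sol N m T u v vr ut) (t : ℝ) : Continuous (fun r => u r t) :=
  h.cu.comp (f := fun r : ℝ => ((r, t) : ℝ × ℝ)) (by fun_prop)
lemma cv_t (h : Sol N m T u v vr ut) (r : ℝ) : Continuous (fun t => v r t) :=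
  h.cv.comp (f := fun t : ℝ => ((r, t) : ℝ × ℝ)) (by fun_prop)
lemma cu_t (h : Sol N m T u v vr ut) (r : ℝ) : Continuous (fun t => u r t) :=
  h.cu.comp (f := fun t : ℝ => ((r, t) : ℝ × ℝ)) (by fun_prop)

lemma flux (h : Sol N m T u v vr ut) {r t : ℝ} (hr : 0 ≤ r) (ht : t ∈ Ioo 0 T) :
    ∫ ρ in (0:ℝ)..r, Sw N ρ * ut ρ t = Sw N r * vr r t := by
  have c1 : ContinuousOn (fun ρ => Sw N ρ * vr ρ t) (Icc 0 r) :=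
    (Sw_cont N).continuousOn.mul ((h.cvr_r ht).mono Icc_subset_Ici_self)
  have c2 : ContinuousOn (fun ρ => Sw N ρ * ut ρ t) (Icc 0 r) :=
    (Sw_cont N).continuousOn.mul ((h.cut_r ht).mono Icc_subset_Ici_self)
  rw [intervalIntegral.integral_eq_sub_of_hasDerivAt_of_le hr c1
    (fun x hx => h.dflux x hx.1 t ht) (c2.intervalIntegrable_of_Icc hr)]
  simp [Sw_zero h.hN]

lemma comparison (h : Sol N m T u v vr ut) {R b : ℝ} (hR : 0 < R) (hbT : b < T)
    (B Bt Br LB : ℝ → ℝ → ℝ)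
    (cB : ContinuousOn (fun p : ℝ × ℝ => B p.1 p.2) (Icc 0 R ×ˢ Icc 0 b))
    (Bpos : ∀ r ∈ Icc 0 R, ∀ t ∈ Icc 0 b, 0 < B r t)
    (dBt : ∀ r ∈ Icc 0 R, ∀ t ∈ Ioc 0 b, HasDerivAt (fun t => B r t) (Bt r t) t)
    (dBr : ∀ r ∈ Ioo 0 R, ∀ t ∈ Ioc 0 b, HasDerivAt (fun r => B r t) (Br r t) r)
    (dF : ∀ r ∈ Ioo 0 R, ∀ t ∈ Ioc 0 b,
      HasDerivAt (fun r => Sw N r * Br r t) (Sw N r * LB r t) r)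
    (cBr : ∀ t ∈ Ioc 0 b, ContinuousOn (fun r => Br r t) (Ico 0 R))
    (cLB : ∀ t ∈ Ioc 0 b, ContinuousOn (fun r => LB r t) (Ico 0 R))
    (strict : ∀ r ∈ Ico 0 R, ∀ t ∈ Ioc 0 b,
      LB r t < 1 / m * B r t ^ (1 / m - 1) * Bt r t)
    (init : ∀ r ∈ Icc 0 R, v r 0 < B r 0)
    (bdry : ∀ t ∈ Icc 0 b, v R t < B R t) :
    ∀ r ∈ Icc 0 R, ∀ t ∈ Icc 0 b, v r t < B r t := by
  by_contra hcon
  push Not at hcon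
  obtain ⟨r1, hr1, t1, ht1, hle⟩ := hcon
  have hK : IsCompact (Icc (0:ℝ) R ×ˢ Icc (0:ℝ) b) := isCompact_Icc.prod isCompact_Icc
  have cz : ContinuousOn (fun p : ℝ × ℝ => B p.1 p.2 - v p.1 p.2) (Icc 0 R ×ˢ Icc 0 b) :=
    cB.sub h.cv.continuousOn
  have hK2 : IsCompact ((Icc (0:ℝ) R ×ˢ Icc (0:ℝ) b) ∩
      (fun p : ℝ × ℝ => B p.1 p.2 - v p.1 p.2) ⁻¹' Iic 0) := by
    have := cz.preimage_isClosed_of_isClosed hK.isClosed isClosed_Iic (t := Iic 0)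
    exact hK.of_isClosed_subset this inter_subset_left
  obtain ⟨⟨r0, t0⟩, ⟨⟨hr0, ht0⟩, hz0⟩, hmin⟩ := hK2.exists_isMinOn
    ⟨(r1, t1), ⟨hr1, ht1⟩, by simpa using hle⟩ continuous_snd.continuousOn
  simp only [mem_preimage, mem_Iic, sub_nonpos] at hr0 ht0 hz0
  have hlt : ∀ r ∈ Icc 0 R, ∀ t ∈ Ico 0 t0, v r t < B r t := by
    intro r hr t ht
    by_contra hc
    have : t0 ≤ t := hmin (a := (r, t)) ⟨⟨hr, ht.1, ht.2.le.trans ht0.2⟩, by simpa using hc⟩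
    exact absurd ht.2 (not_lt.2 this)
  have ht00 : 0 < t0 := by
    rcases ht0.1.eq_or_lt with h0 | h0
    · exact absurd hz0 (not_le.2 (by rw [← h0]; exact init r0 hr0))
    · exact h0
  have htI : t0 ∈ Ioc 0 b := ⟨ht00, ht0.2⟩
  have htT : t0 ∈ Ioo 0 T := ⟨ht00, ht0.2.trans_lt hbT⟩
  have hle0 : ∀ r ∈ Icc 0 R, v r t0 ≤ B r t0 := by
    intro r hr
    have hev : ∀ᶠ t in 𝓝[<] t0, v r t ≤ B r t := by
      filter_upwards [Ico_mem_nhdsLT ht00] with t ht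
      exact (hlt r hr t ht).le
    exact le_of_tendsto_of_tendsto ((h.cv_t r).continuousAt.mono_left nhdsWithin_le_nhds)
      ((dBt r hr t0 htI).continuousAt.mono_left nhdsWithin_le_nhds) hev
  have heq : v r0 t0 = B r0 t0 := le_antisymm (hle0 r0 hr0) hz0
  have hrR : r0 < R := by
    rcases hr0.2.eq_or_lt with h0 | h0
    · rw [h0] at heq; exact absurd heq (bdry t0 ht0).ne
    · exact h0
  -- time derivative
  have hder : 0 ≤ m * u r0 t0 ^ (m - 1) * ut r0 t0 - Bt r0 t0 := by
    have hd := ((h.dvt hr0.1 htT).sub (dBt r0 hr0 t0 htI)).hasDerivWithinAt (s := Iio t0)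
    rw [hasDerivWithinAt_iff_tendsto_slope' (by simp)] at hd
    refine ge_of_tendsto hd ?_
    filter_upwards [Ico_mem_nhdsLT ht00] with t ht
    rw [slope_def_field]
    have h1 := hlt r0 hr0 t ht
    apply div_nonneg_of_nonpos
    · simp only [Pi.sub_apply]; rw [heq]; linarith
    · linarith [ht.2]
  have hB0 := Bpos r0 hr0 t0 ht0
  have hu0 := h.pos r0 hr0.1 t0 htT
  have hmm := h.m0
  have hkey : B r0 t0 ^ (1 / m - 1) * u r0 t0 ^ (m - 1) = 1 := by
    rw [← heq, h.veq, ← Real.rpow_mul hu0.le, ← Real.rpow_add hu0]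
    have : m * (1 / m - 1) + (m - 1) = 0 := by field_simp; ring
    rw [this, Real.rpow_zero]
  have hut : LB r0 t0 < ut r0 t0 := by
    refine (strict r0 ⟨hr0.1, hrR⟩ t0 htI).trans_le ?_
    have hBp : 0 < B r0 t0 ^ (1 / m - 1) := Real.rpow_pos_of_pos hB0 _
    calc 1 / m * B r0 t0 ^ (1 / m - 1) * Bt r0 t0
        ≤ 1 / m * B r0 t0 ^ (1 / m - 1) * (m * u r0 t0 ^ (m - 1) * ut r0 t0) := by
          apply mul_le_mul_of_nonneg_left (by linarith) (by positivity)
      _ = (B r0 t0 ^ (1 / m - 1) * u r0 t0 ^ (m - 1)) * ut r0 t0 := by field_simp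
      _ = ut r0 t0 := by rw [hkey, one_mul]
  -- neighbourhood on the right
  have hc : ContinuousOn (fun r => ut r t0 - LB r t0) (Ico 0 R) :=
    ((h.cut_r htT).mono Ico_subset_Ici_self).sub (cLB t0 htI)
  have hev : ∀ᶠ r in 𝓝[Ico 0 R] r0, 0 < ut r t0 - LB r t0 :=
    (hc r0 ⟨hr0.1, hrR⟩).eventually (lt_mem_nhds (by linarith))
  have hev2 : ∀ᶠ r in 𝓝[>] r0, 0 < ut r t0 - LB r t0 := by
    have : 𝓝[>] r0 ≤ 𝓝[Ico 0 R] r0 := by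
      rw [← nhdsWithin_Ioo_eq_nhdsGT hrR]
      exact nhdsWithin_mono _ (fun x hx => ⟨hr0.1.trans hx.1.le, hx.2⟩)
    exact this hev
  obtain ⟨r2, hr2, hsub⟩ := (mem_nhdsGT_iff_exists_Ioo_subset' hrR).1
    (inter_mem hev2 (Ioo_mem_nhdsGT hrR))
  have hr2' : r0 < r2 := hr2
  have hsubs : ∀ x ∈ Ioo r0 r2, 0 < ut x t0 - LB x t0 ∧ x ∈ Ioo 0 R := fun x hx =>
    ⟨(hsub hx).1, ⟨hr0.1.trans_lt (hsub hx).2.1, (hsub hx).2.2⟩⟩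
  have hP0 : Sw N r0 * (vr r0 t0 - Br r0 t0) = 0 := by
    rcases hr0.1.eq_or_lt with h0 | h0
    · rw [← h0, Sw_zero h.hN, zero_mul]
    · have hmax : IsLocalMax (fun r => v r t0 - B r t0) r0 := by
        filter_upwards [Ioo_mem_nhds h0 hrR] with x hx
        have := hle0 x ⟨hx.1.le, hx.2.le⟩
        simp only [heq]; linarith
      have := hmax.hasDerivAt_eq_zero ((h.dv r0 h0 t0 htT).sub (dBr r0 ⟨h0, hrR⟩ t0 htI))
      rw [this, mul_zero]
  have hP : StrictMonoOn (fun r => Sw N r * (vr r t0 - Br r t0)) (Ico r0 r2) := by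
    have hss : Ico r0 r2 ⊆ Ico 0 R := by
      intro x hx
      rcases hx.1.eq_or_lt with h0 | h0
      · rw [← h0]; exact ⟨hr0.1, hrR⟩
      · have := (hsubs x ⟨h0, hx.2⟩).2; exact ⟨this.1.le, this.2⟩
    apply strictMonoOn_of_hasDerivWithinAt_pos (convex_Ico _ _)
      (f' := fun x => Sw N x * (ut x t0 - LB x t0))
    · exact (Sw_cont N).continuousOn.mul
        ((((h.cvr_r htT).mono Ico_subset_Ici_self).mono hss).sub ((cBr t0 htI).mono hss))
    · intro x hx
      rw [interior_Ico] at hx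
      have := (h.dflux x (hsubs x hx).2.1 t0 htT).sub (dF x (hsubs x hx).2 t0 htI)
      refine HasDerivAt.hasDerivWithinAt ?_
      convert this using 1
      · funext x; simp [mul_sub]
      · ring
    · intro x hx
      rw [interior_Ico] at hx
      exact mul_pos (Sw_pos N (hsubs x hx).2.1) (hsubs x hx).1
  have hz : StrictMonoOn (fun r => v r t0 - B r t0) (Ico r0 r2) := by
    apply strictMonoOn_of_hasDerivWithinAt_pos (convex_Ico _ _)
      (f' := fun x => vr x t0 - Br x t0)
    · apply (h.cv_r t0).continuousOn.sub
      refine cB.comp (f := fun r : ℝ => ((r, t0) : ℝ × ℝ)) (by fun_prop) ?_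
      intro x hx
      refine ⟨⟨hr0.1.trans hx.1, ?_⟩, ht0⟩
      rcases hx.1.eq_or_lt with h0 | h0
      · rw [← h0]; exact hrR.le
      · exact (hsubs x ⟨h0, hx.2⟩).2.2.le
    · intro x hx
      rw [interior_Ico] at hx
      exact ((h.dv x (hsubs x hx).2.1 t0 htT).sub
        (dBr x (hsubs x hx).2 t0 htI)).hasDerivWithinAt
    · intro x hx
      rw [interior_Ico] at hx
      have h1 := hP ⟨le_rfl, hr2'⟩ ⟨hx.1.le, hx.2⟩ hx.1
      simp only [hP0] at h1
      exact (pos_iff_pos_of_mul_pos h1).1 (Sw_pos N (hsubs x hx).2.1)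
  have hm1 : (r0 + r2) / 2 ∈ Ioo r0 r2 := ⟨by linarith, by linarith⟩
  have h1 := hz ⟨le_rfl, hr2'⟩ ⟨hm1.1.le, hm1.2⟩ hm1.1
  simp only [heq, sub_self] at h1
  have h2 := hle0 _ ⟨(hsubs _ hm1).2.1.le, (hsubs _ hm1).2.2.le⟩
  linarith

end Sol

/-- log cosh -/
noncomputable def lc (r : ℝ) : ℝ := Real.log (Real.cosh r)

lemma lc_deriv (r : ℝ) : HasDerivAt lc (Real.tanh r) r := by
  unfold lc
  have := (Real.hasDerivAt_cosh r).log (Real.cosh_pos r).ne'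
  rwa [← Real.tanh_eq_sinh_div_cosh] at this

lemma lc_cont : Continuous lc := by
  unfold lc; exact Real.continuous_cosh.log (fun r => (Real.cosh_pos r).ne')

lemma lc_nonneg (r : ℝ) : 0 ≤ lc r := Real.log_nonneg (Real.one_le_cosh r)

lemma lc_lower (r : ℝ) : r - Real.log 2 ≤ lc r := by
  unfold lc
  rw [sub_le_iff_le_add, ← Real.log_mul (Real.cosh_pos r).ne' (by norm_num),
    Real.le_log_iff_exp_le (by have := Real.cosh_pos r; positivity), Real.cosh_eq]
  have := Real.exp_pos (-r); linarith

lemma lc_mono {a b : ℝ} (ha : 0 ≤ a) (hab : a ≤ b) : lc a ≤ lc b := by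
  unfold lc
  apply Real.log_le_log (Real.cosh_pos a)
  rw [Real.cosh_le_cosh, abs_of_nonneg ha, abs_of_nonneg (ha.trans hab)]; exact hab

lemma tanh_deriv' (r : ℝ) : HasDerivAt Real.tanh (1 - Real.tanh r ^ 2) r := by
  have h := (Real.hasDerivAt_sinh r).div (Real.hasDerivAt_cosh r) (Real.cosh_pos r).ne'
  have e : Real.tanh = Real.sinh / Real.cosh := by
    funext x; exact Real.tanh_eq_sinh_div_cosh x
  rw [e]
  refine h.congr_deriv ?_
  have := (Real.cosh_pos r).ne'
  simp only [Pi.div_apply]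
  field_simp

lemma tanh_cont : Continuous Real.tanh :=
  continuous_iff_continuousAt.2 fun r => (tanh_deriv' r).continuousAt

lemma tanh_sq_le (r : ℝ) : Real.tanh r ^ 2 ≤ 1 := by
  rw [Real.tanh_eq_sinh_div_cosh, div_pow, div_le_one (by have := Real.cosh_pos r; positivity)]
  have := Real.cosh_sq r; linarith

lemma flux_lc {N : ℕ} (hN : 2 ≤ N) (f1 : ℝ → ℝ) (f2 r : ℝ) 
    (hf : HasDerivAt f1 f2 (lc r)) :
    HasDerivAt (fun r => Sw N r * (f1 (lc r) * Real.tanh r))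
      (Sw N r * (f2 * Real.tanh r ^ 2 + f1 (lc r) * (N - Real.tanh r ^ 2))) r := by
  have h := (Sw_deriv hN r).mul (((hf.comp r (lc_deriv r))).mul (tanh_deriv' r))
  refine h.congr_deriv ?_
  have e1 : Real.sinh r ^ (N - 2) * Real.cosh r * Real.tanh r = Sw N r := by
    unfold Sw
    have : N - 1 = (N - 2) + 1 := by omega
    rw [this, pow_succ, Real.tanh_eq_sinh_div_cosh]
    have := (Real.cosh_pos r).ne'
    field_simp
  simp only [Function.comp, Pi.mul_apply]
  linear_combination (f1 (lc r) * (N - 1)) * e1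

lemma barrier_strict {A m K L α q c s N y τ E : ℝ} (hE0 : 0 < E) (hA : 0 < A) (hm0 : 0 < m) (hm1 : m < 1)
    (hNr : 2 ≤ N) (hK0 : 0 < K) (hc : c = m * q * (q + 1) + m * q * N * L)
    (hα : α = (N - 1) / 2)
    (hK1 : K ^ (1 / m - 1) = c)
    (hpos : 0 < y) (hposL : y ≤ L) (hqm : -q - 2 = -q * (1 / m)) (hq0 : 0 < q)
    (hs : 0 ≤ s) (hL0 : 0 < L) (hτ0 : 0 ≤ τ) (hτ1 : τ ≤ 1) :
    (A * (α ^ 2 * E) + Real.exp s * (K * (q * ((q + 1) * y ^ (-q - 2))))) * τ +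
      (A * (-α * E) + Real.exp s * (K * (q * y ^ (-q - 1)))) * (N - τ)
    < 1 / m * (A * E + Real.exp s * (K * y ^ (-q))) ^ (1 / m - 1) *
      (Real.exp s * (K * y ^ (-q))) := by
  have hes : 1 ≤ Real.exp s := Real.one_le_exp hs
  have hα0 : 0 < α := by rw [hα]; linarith
  set Y := y ^ (-q - 2) with hY
  have hY0 : 0 < Y := Real.rpow_pos_of_pos hpos _
  have hY1 : y ^ (-q - 1) = Y * y := by
    rw [hY, ← Real.rpow_add_one hpos.ne']; congr 1; ring
  set g := K * y ^ (-q) with hg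
  have hg0 : 0 < g := by positivity
  have hgp : g ^ (1 / m - 1) * g = c * K * Y := by
    have e1 : g ^ (1 / m - 1) * g = g ^ (1 / m) := by
      rw [← Real.rpow_add_one hg0.ne']; congr 1; ring
    rw [e1, hg, Real.mul_rpow hK0.le (by positivity), ← Real.rpow_mul hpos.le, ← hqm, ← hY]
    have e2 : K ^ (1 / m) = K ^ (1 / m - 1) * K := by
      rw [← Real.rpow_add_one hK0.ne']; congr 1; ring
    rw [e2, hK1]
  have h1m : 0 < 1 / m - 1 := by rw [sub_pos, lt_div_iff₀ hm0]; linarith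
  have hB : g ≤ A * E + Real.exp s * g := by
    have : g ≤ Real.exp s * g := le_mul_of_one_le_left hg0.le hes
    have : 0 < A * E := by positivity
    linarith
  have hmono := Real.rpow_le_rpow hg0.le hB h1m.le
  rw [hY1]
  have hk1 : A * (α ^ 2 * E) * τ + A * (-α * E) * (N - τ) < 0 := by
    have : A * (α ^ 2 * E) * τ + A * (-α * E) * (N - τ)
      = A * α * E * (α * τ - (N - τ)) := by ring
    rw [this]
    apply mul_neg_of_pos_of_neg (by positivity)
    rw [hα]
    nlinarith
  have hk2 : (K * (q * ((q + 1) * Y))) * τ + K * (q * (Y * y)) * (N - τ)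
      ≤ 1 / m * (c * K * Y) := by
    have e1 : 1 / m * (c * K * Y) = K * Y * q * ((q + 1) + N * L) := by
      rw [hc]; field_simp
    have e2 : (K * (q * ((q + 1) * Y))) * τ + K * (q * (Y * y)) * (N - τ)
      = K * Y * q * ((q + 1) * τ + y * (N - τ)) := by ring
    rw [e1, e2]
    apply mul_le_mul_of_nonneg_left _ (by positivity)
    have e3 : (q + 1) * τ ≤ q + 1 := by nlinarith
    have e4 : y * (N - τ) ≤ N * L := by nlinarith
    linarith
  calc (A * (α ^ 2 * E) + Real.exp s * (K * (q * ((q + 1) * Y)))) * τ +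
        (A * (-α * E) + Real.exp s * (K * (q * (Y * y)))) * (N - τ)
      = (A * (α ^ 2 * E) * τ + A * (-α * E) * (N - τ)) + Real.exp s *
        ((K * (q * ((q + 1) * Y))) * τ + K * (q * (Y * y)) * (N - τ)) := by ring
    _ < 0 + Real.exp s * (1 / m * (c * K * Y)) := by
        apply add_lt_add_of_lt_of_le hk1
        exact mul_le_mul_of_nonneg_left hk2 (Real.exp_pos s).le
    _ = 1 / m * g ^ (1 / m - 1) * (Real.exp s * g) := by rw [← hgp]; ring
    _ ≤ _ := by
        apply mul_le_mul_of_nonneg_right _ (by positivity)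
        exact mul_le_mul_of_nonneg_left hmono (by positivity)

namespace Sol
variable {N : ℕ} {m T : ℝ} {u v vr ut : ℝ → ℝ → ℝ}

set_option maxHeartbeats 1000000 in
lemma barrier (h : Sol N m T u v vr ut) {A : ℝ} (hA : 0 < A)
    (hinit : ∀ r, 0 ≤ r → v r 0 ≤ A * Real.exp (-(((N:ℝ) - 1) / 2) * lc r))
    {r t L : ℝ} (hr : 0 ≤ r) (ht : 0 ≤ t) (htT : t < T) (hL : lc r < L) :
    v r t ≤ A * Real.exp (-(((N:ℝ) - 1) / 2) * lc r) +
      Real.exp t * ((m * (2 * m / (1 - m)) * (2 * m / (1 - m) + 1) +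
        m * (2 * m / (1 - m)) * N * L) ^ (m / (1 - m)) * (L - lc r) ^ (-(2 * m / (1 - m)))) := by
  have hm0 := h.m0
  have hm1 : 0 < 1 - m := by linarith [h.m1]
  set q := 2 * m / (1 - m) with hq
  have hq0 : 0 < q := by positivity
  have hqm : -q - 2 = -q * (1 / m) := by rw [hq]; field_simp; ring
  have hL0 : 0 < L := (lc_nonneg r).trans_lt hL
  have hNr : (2:ℝ) ≤ N := by exact_mod_cast h.hN
  set c := m * q * (q + 1) + m * q * N * L with hc
  have hc0 : 0 < c := by positivity
  set K := c ^ (m / (1 - m)) with hK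
  have hK0 : 0 < K := Real.rpow_pos_of_pos hc0 _
  have hK1 : K ^ (1 / m - 1) = c := by
    rw [hK, ← Real.rpow_mul hc0.le]
    have : m / (1 - m) * (1 / m - 1) = 1 := by field_simp
    rw [this, Real.rpow_one]
  set α := ((N:ℝ) - 1) / 2 with hα
  have hα0 : 0 < α := by rw [hα]; linarith
  -- bound on v
  obtain ⟨M, hM⟩ := (isCompact_Icc.prod isCompact_Icc :
    IsCompact (Icc (0:ℝ) (L + Real.log 2) ×ˢ Icc (0:ℝ) T)).bddAbove_image
      h.cv.continuousOn
  have hM' : ∀ x, 0 ≤ x → lc x ≤ L → ∀ s ∈ Icc 0 T, v x s ≤ M := by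
    intro x hx hxL s hs
    apply hM
    refine ⟨(x, s), ⟨⟨hx, ?_⟩, hs⟩, rfl⟩
    have := lc_lower x; linarith
  -- choose δ
  have hδ : ∃ δ, 0 < δ ∧ δ < L - lc r ∧ M < K * δ ^ (-q) := by
    have ht1 : Tendsto (fun δ : ℝ => K * δ ^ (-q)) (𝓝[>] 0) atTop :=
      (tendsto_rpow_neg_nhdsGT_zero (by linarith)).const_mul_atTop hK0
    have := ((ht1.eventually_gt_atTop M).and (Ioo_mem_nhdsGT (sub_pos.2 hL))).exists
    obtain ⟨δ, h1, h2⟩ := this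
    exact ⟨δ, h2.1, h2.2, h1⟩
  obtain ⟨δ, hδ0, hδr, hδM⟩ := hδ
  obtain ⟨R, hR, hRδ⟩ : ∃ R, r ≤ R ∧ lc R = L - δ := by
    have hle : r ≤ max r (L + Real.log 2) := le_max_left _ _
    have : L - δ ∈ Icc (lc r) (lc (max r (L + Real.log 2))) := by
      constructor
      · linarith
      · have h1 := lc_lower (L + Real.log 2)
        have hl2 : 0 < Real.log 2 := Real.log_pos (by norm_num)
        have h2 := lc_mono (a := L + Real.log 2) (by linarith) (le_max_right r (L + Real.log 2))
        linarith
    obtain ⟨R, hR, h2⟩ := intermediate_value_Icc hle lc_cont.continuousOn this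
    exact ⟨R, hR.1, h2⟩
  have hrR : r < R := by
    rcases hR.eq_or_lt with h0 | h0
    · rw [← h0] at hRδ; linarith
    · exact h0
  have hR0 : 0 < R := hr.trans_lt hrR
  have hlt : ∀ x ∈ Icc 0 R, 0 < L - lc x := by
    intro x hx
    have := lc_mono hx.1 hx.2
    linarith
  have main := h.comparison (R := R) (b := t) hR0 htT
    (fun x s => A * Real.exp (-α * lc x) + Real.exp s * (K * (L - lc x) ^ (-q)))
    (fun x s => Real.exp s * (K * (L - lc x) ^ (-q)))
    (fun x s => (A * (-α * Real.exp (-α * lc x)) +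
      Real.exp s * (K * (q * (L - lc x) ^ (-q - 1)))) * Real.tanh x)
    (fun x s => (A * (α ^ 2 * Real.exp (-α * lc x)) +
      Real.exp s * (K * (q * ((q + 1) * (L - lc x) ^ (-q - 2))))) * Real.tanh x ^ 2 +
      (A * (-α * Real.exp (-α * lc x)) +
      Real.exp s * (K * (q * (L - lc x) ^ (-q - 1)))) * (N - Real.tanh x ^ 2))
    ?_ ?_ ?_ ?_ ?_ ?_ ?_ ?_ ?_ ?_ r ⟨hr, hR⟩ t ⟨ht, le_rfl⟩
  · exact main.le
  · have hl := lc_cont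
    refine ContinuousOn.add (by fun_prop) (ContinuousOn.mul (by fun_prop)
      (ContinuousOn.mul (by fun_prop) ?_))
    exact ContinuousOn.rpow_const (by fun_prop) (fun p hp => Or.inl (hlt p.1 hp.1).ne')
  · intro x hx s hs
    have := hlt x hx
    positivity
  · intro x hx s hs
    exact ((Real.hasDerivAt_exp s).mul_const _).const_add _
  · intro x hx s hs
    have hpos := hlt x ⟨hx.1.le, hx.2.le⟩
    have h1 : HasDerivAt (fun x => A * Real.exp (-α * lc x))
        (A * (Real.exp (-α * lc x) * (-α * Real.tanh x))) x :=
      (((lc_deriv x).const_mul (-α)).exp).const_mul A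
    have h2 := ((((lc_deriv x).const_sub L).rpow_const (p := -q)
      (Or.inl hpos.ne')).const_mul K).const_mul (Real.exp s)
    refine (h1.add h2).congr_deriv ?_
    ring
  · intro x hx s hs
    have hpos := hlt x ⟨hx.1.le, hx.2.le⟩
    apply flux_lc h.hN (fun y => A * (-α * Real.exp (-α * y)) +
      Real.exp s * (K * (q * (L - y) ^ (-q - 1))))
    have h1 : HasDerivAt (fun y => A * (-α * Real.exp (-α * y)))
        (A * (-α * (Real.exp (-α * lc x) * (-α * 1)))) (lc x) :=
      ((((hasDerivAt_id (lc x)).const_mul (-α)).exp).const_mul (-α)).const_mul A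
    have h2 := (((((hasDerivAt_id (lc x)).const_sub L).rpow_const (p := -q - 1)
      (Or.inl hpos.ne')).const_mul q).const_mul K).const_mul (Real.exp s)
    refine (h1.add h2).congr_deriv ?_
    rw [show -q - 1 - 1 = -q - 2 by ring]
    simp only [id]
    ring
  · intro s hs
    have hl := lc_cont
    have ht := tanh_cont
    refine ContinuousOn.mul (ContinuousOn.add (by fun_prop) (ContinuousOn.mul (by fun_prop)
      (ContinuousOn.mul (by fun_prop) (ContinuousOn.mul (by fun_prop) ?_)))) (by fun_prop)
    exact ContinuousOn.rpow_const (by fun_prop) (fun p hp => Or.inl (hlt p ⟨hp.1, hp.2.le⟩).ne')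
  · intro s hs
    have hl := lc_cont
    have ht := tanh_cont
    have e1 : ∀ z : ℝ, ContinuousOn (fun x => (L - lc x) ^ z) (Ico 0 R) := fun z =>
      ContinuousOn.rpow_const (by fun_prop) (fun p hp => Or.inl (hlt p ⟨hp.1, hp.2.le⟩).ne')
    have e2 := e1 (-q - 1)
    have e3 := e1 (-q - 2)
    fun_prop
  · intro x hx s hs
    have hpos := hlt x ⟨hx.1, hx.2.le⟩
    have hposL : L - lc x ≤ L := by linarith [lc_nonneg x]
    exact barrier_strict (Real.exp_pos _) hA hm0 h.m1 hNr hK0 hc hα hK1 hpos hposL hqm hq0 hs.1.le hL0 (sq_nonneg _) (tanh_sq_le x)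
  · intro x hx
    have hpos := hlt x hx
    have : 0 < Real.exp 0 * (K * (L - lc x) ^ (-q)) := by positivity
    have := hinit x hx.1
    linarith
  · intro s hs
    have hpos := hlt R ⟨hR0.le, le_rfl⟩
    have h1 := hM' R hR0.le (by linarith) s ⟨hs.1, hs.2.trans htT.le⟩
    have h2 : L - lc R = δ := by linarith
    rw [h2]
    have h3 : K * δ ^ (-q) ≤ Real.exp s * (K * δ ^ (-q)) :=
      le_mul_of_one_le_left (by positivity) (Real.one_le_exp hs.1)
    have : 0 < A * Real.exp (-α * lc R) := by positivity
    linarith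

lemma decay_of_init (h : Sol N m T u v vr ut) {A : ℝ} (hA : 0 < A)
    (hinit : ∀ r, 0 ≤ r → v r 0 ≤ A * Real.exp (-(((N:ℝ) - 1) / 2) * lc r))
    {r t : ℝ} (hr : 0 ≤ r) (ht : 0 ≤ t) (htT : t < T) :
    v r t ≤ A * Real.exp (-(((N:ℝ) - 1) / 2) * lc r) := by
  have hm0 := h.m0
  have hm1 : 0 < 1 - m := by linarith [h.m1]
  have hNr : (2:ℝ) ≤ N := by exact_mod_cast h.hN
  set q := 2 * m / (1 - m) with hq
  have hq0 : 0 < q := by positivity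
  have lim : Tendsto (fun L : ℝ => A * Real.exp (-(((N:ℝ) - 1) / 2) * lc r) +
      Real.exp t * ((m * q * (q + 1) + m * q * N * L) ^ (m / (1 - m)) * (L - lc r) ^ (-q)))
      atTop (𝓝 (A * Real.exp (-(((N:ℝ) - 1) / 2) * lc r) + Real.exp t * 0)) := by
    apply Tendsto.const_add
    apply Tendsto.const_mul
    have hp : 0 < m / (1 - m) := by positivity
    have h1 : Tendsto (fun L : ℝ => (m * q * (q + 1) + m * q * N * L) / (L - lc r) ^ 2) atTop (𝓝 0) := by
      have e0 : Tendsto (fun L : ℝ => (L - lc r)⁻¹) atTop (𝓝 0) :=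
        tendsto_inv_atTop_zero.comp (tendsto_atTop_add_const_right _ _ tendsto_id)
      have e1 : Tendsto (fun L : ℝ => (m * q * (q + 1) + m * q * N * lc r) * (L - lc r)⁻¹ ^ 2 +
        m * q * N * (L - lc r)⁻¹) atTop
          (𝓝 ((m * q * (q + 1) + m * q * N * lc r) * 0 ^ 2 + m * q * N * 0)) :=
        ((e0.pow 2).const_mul _).add (e0.const_mul _)
      simp only [ne_eq, OfNat.ofNat_ne_zero, not_false_eq_true, zero_pow, mul_zero, add_zero] at e1
      refine e1.congr' ?_
      filter_upwards [eventually_gt_atTop (lc r)] with L hL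
      have : L - lc r ≠ 0 := by linarith
      field_simp
      ring
    have h2 := h1.rpow_const (p := m / (1 - m)) (Or.inr hp.le)
    rw [Real.zero_rpow hp.ne'] at h2
    refine h2.congr' ?_
    filter_upwards [eventually_gt_atTop (lc r)] with L hL
    have hL' : 0 < L - lc r := by linarith
    have hL0 : 0 < L := (lc_nonneg r).trans_lt hL
    rw [Real.div_rpow (by positivity) (by positivity), Real.rpow_neg hL'.le, div_eq_mul_inv,
      ← Real.rpow_natCast, ← Real.rpow_mul hL'.le]
    congr 3
    rw [hq]; push_cast; ring
  rw [mul_zero, add_zero] at lim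
  apply ge_of_tendsto lim
  filter_upwards [eventually_gt_atTop (lc r)] with L hL
  exact h.barrier hA hinit hr ht htT hL

end Sol

lemma sq_intOn {N : ℕ} {f : ℝ → ℝ} (hf : Measurable f)
    (hi : IntegrableOn (fun s => f s ^ 2 * Sw N s) (Ioi 0)) {a b : ℝ} (ha : 0 < a) :
    IntegrableOn (fun s => f s ^ 2) (Ioc a b) := by
  have h1 : IntegrableOn (fun s => (Sw N a)⁻¹ * (f s ^ 2 * Sw N s)) (Ioc a b) :=
    (hi.mono_set (fun x hx => ha.trans hx.1)).const_mul _
  refine h1.mono' (hf.pow_const 2).aestronglyMeasurable ?_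
  filter_upwards [ae_restrict_mem measurableSet_Ioc] with x hx
  have hSa := Sw_pos N ha
  have hm := Sw_mono N ha.le hx.1.le
  rw [Real.norm_of_nonneg (sq_nonneg _), inv_mul_eq_div, le_div_iff₀ hSa]
  exact mul_le_mul_of_nonneg_left hm (sq_nonneg _)

lemma intOn_of_sq {f : ℝ → ℝ} (hf : Measurable f) {a b : ℝ}
    (h : IntegrableOn (fun s => f s ^ 2) (Ioc a b)) : IntegrableOn f (Ioc a b) := by
  have h1 : IntegrableOn (fun s => f s ^ 2 + 1) (Ioc a b) := h.add (by simp)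
  refine h1.mono' hf.aestronglyMeasurable (Eventually.of_forall fun x => ?_)
  rw [Real.norm_eq_abs]
  nlinarith [sq_abs (f x), sq_nonneg (|f x| - 1), abs_nonneg (f x)]

lemma loc_bound {N : ℕ} {f : ℝ → ℝ} (hf : Measurable f)
    (hi : IntegrableOn (fun s => f s ^ 2 * Sw N s) (Ioi 0)) {r E κ : ℝ} (hr : 1 ≤ r) 
    (hE : 0 < E) (hκ : 0 < κ) (hS : κ ≤ Sw N r * E ^ 2) :
    ∫ s in Ioc r (r + 1), |f s| ≤
      E * ((∫ s in Ioi 0, f s ^ 2 * Sw N s) / κ + 1) / 2 := by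
  have hr0 : 0 < r := by linarith
  have i2 := sq_intOn hf hi hr0 (b := r + 1)
  have i1 := intOn_of_sq hf i2
  have hSr := Sw_pos N hr0
  set H := ∫ s in Ioi 0, f s ^ 2 * Sw N s
  have h1 : ∫ s in Ioc r (r + 1), f s ^ 2 ≤ (Sw N r)⁻¹ * H := by
    calc ∫ s in Ioc r (r + 1), f s ^ 2 
        ≤ ∫ s in Ioc r (r + 1), (Sw N r)⁻¹ * (f s ^ 2 * Sw N s) := by
          apply setIntegral_mono_on i2
            ((hi.mono_set (fun x hx => hr0.trans hx.1)).const_mul _) measurableSet_Ioc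
          intro x hx
          rw [inv_mul_eq_div, le_div_iff₀ hSr]
          exact mul_le_mul_of_nonneg_left (Sw_mono N hr0.le hx.1.le) (sq_nonneg _)
      _ = (Sw N r)⁻¹ * ∫ s in Ioc r (r + 1), (f s ^ 2 * Sw N s) := integral_const_mul _ _
      _ ≤ (Sw N r)⁻¹ * H := by
          apply mul_le_mul_of_nonneg_left _ (by positivity)
          apply setIntegral_mono_set hi
          · filter_upwards [ae_restrict_mem measurableSet_Ioi] with x hx
            exact mul_nonneg (sq_nonneg _) (Sw_nonneg N (le_of_lt hx))
          · exact (HasSubset.Subset.eventuallyLE (fun x hx => hr0.trans hx.1))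
  have hH0 : 0 ≤ H := setIntegral_nonneg measurableSet_Ioi
    (fun x hx => mul_nonneg (sq_nonneg _) (Sw_nonneg N (le_of_lt hx)))
  have h2 : (Sw N r)⁻¹ * H ≤ E ^ 2 * (H / κ) := by
    rw [inv_mul_eq_div, div_le_iff₀ hSr]
    calc H = κ * (H / κ) := by field_simp
      _ ≤ (Sw N r * E ^ 2) * (H / κ) := mul_le_mul_of_nonneg_right hS (by positivity)
      _ = _ := by ring
  calc ∫ s in Ioc r (r + 1), |f s| 
      ≤ ∫ s in Ioc r (r + 1), ((E⁻¹ / 2) * f s ^ 2 + E / 2) := by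
        apply setIntegral_mono i1.abs ((i2.const_mul _).add (by simp))
        intro x
        have : (E⁻¹ / 2) * f x ^ 2 + E / 2 - |f x| = E⁻¹ / 2 * (|f x| - E) ^ 2 := by
          have h0 := sq_abs (f x)
          rw [← h0]
          field_simp; ring
        have h3 : 0 ≤ E⁻¹ / 2 * (|f x| - E) ^ 2 := by positivity
        show |f x| ≤ E⁻¹ / 2 * f x ^ 2 + E / 2
        linarith
    _ = (E⁻¹ / 2) * (∫ s in Ioc r (r + 1), f s ^ 2) + E / 2 := by
        rw [integral_add (i2.const_mul _) (by simp), integral_const_mul]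
        simp
    _ ≤ (E⁻¹ / 2) * (E ^ 2 * (H / κ)) + E / 2 := by
        have := h1.trans h2
        gcongr
    _ = _ := by field_simp

lemma init_decay {N : ℕ} (hN : 2 ≤ N) {w : ℝ → ℝ} (hw : Continuous w) (hw0 : ∀ r, 0 ≤ w r)
    (h1 : MemH1rad N w) :
    ∃ A, 0 < A ∧ ∀ r, 0 ≤ r → w r ≤ A * Real.exp (-(((N:ℝ) - 1) / 2) * lc r) := by
  obtain ⟨hac, hi1, hi2⟩ := h1
  obtain ⟨M, hM⟩ := (isCompact_Icc (a := (0:ℝ)) (b := 1)).bddAbove_image hw.continuousOn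
  obtain ⟨M2, hM2⟩ := (isCompact_Icc (a := (0:ℝ)) (b := 1)).bddAbove_image
    (f := fun r => Real.exp (((N:ℝ) - 1) / 2 * lc r)) (by
      have := lc_cont; fun_prop)
  set κ := Real.tanh 1 ^ (N - 1) with hκ
  have ht1 : 0 < Real.tanh 1 := by
    rw [Real.tanh_eq_sinh_div_cosh]
    exact div_pos (Real.sinh_pos_iff.2 one_pos) (Real.cosh_pos 1)
  have hκ0 : 0 < κ := pow_pos ht1 _
  set C1 := ((∫ s in Ioi 0, w s ^ 2 * Sw N s) / κ + 1) / 2 with hC1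
  set C2 := ((∫ s in Ioi 0, deriv w s ^ 2 * Sw N s) / κ + 1) / 2 with hC2
  refine ⟨|M| * |M2| + |C1 + C2| + 1, by positivity, fun r hr => ?_⟩
  set E := Real.exp (-(((N:ℝ) - 1) / 2) * lc r) with hE
  have hE0 : 0 < E := Real.exp_pos _
  rcases le_total r 1 with hr1 | hr1
  · have e1 : w r ≤ M := hM ⟨r, ⟨hr, hr1⟩, rfl⟩
    have e2 : Real.exp (((N:ℝ) - 1) / 2 * lc r) ≤ M2 := hM2 ⟨r, ⟨hr, hr1⟩, rfl⟩
    have e3 : Real.exp (((N:ℝ) - 1) / 2 * lc r) * E = 1 := by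
      rw [hE, ← Real.exp_add]; simp
    have e4 : 1 ≤ |M2| * E := by
      rw [← e3]; exact mul_le_mul_of_nonneg_right (e2.trans (le_abs_self _)) hE0.le
    calc w r ≤ |M| * 1 := by rw [mul_one]; exact e1.trans (le_abs_self _)
      _ ≤ |M| * (|M2| * E) := mul_le_mul_of_nonneg_left e4 (abs_nonneg _)
      _ ≤ _ := by
        have : 0 ≤ (|C1 + C2| + 1) * E := by positivity
        linarith
  · have hr0 : 0 < r := by linarith
    have hS : κ ≤ Sw N r * E ^ 2 := by
      have e1 : E ^ 2 = ((Real.cosh r) ^ (N - 1))⁻¹ := by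
        have hc := Real.cosh_pos r
        rw [hE, ← Real.exp_nat_mul]
        have : ((N - 1 : ℕ) : ℝ) = (N:ℝ) - 1 := by
          rw [Nat.cast_sub (by omega)]; simp
        rw [← Real.rpow_natCast, this, ← Real.rpow_neg hc.le, Real.rpow_def_of_pos hc]
        congr 1
        unfold lc; push_cast; ring
      rw [e1, hκ]
      unfold Sw
      rw [← div_eq_mul_inv, ← div_pow, ← Real.tanh_eq_sinh_div_cosh]
      apply pow_le_pow_left₀ ht1.le
      have hmono : Monotone Real.tanh := by
        apply monotone_of_deriv_nonneg (fun x => (tanh_deriv' x).differentiableAt)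
        intro x; rw [(tanh_deriv' x).deriv]; linarith [tanh_sq_le x]
      exact hmono hr1
    have b1 := loc_bound hw.measurable hi1 hr1 hE0 hκ0 hS
    have b2 := loc_bound (measurable_deriv w) hi2 hr1 hE0 hκ0 hS
    have id := intOn_of_sq (measurable_deriv w) (sq_intOn (measurable_deriv w) hi2 hr0 (b := r + 1))
    set J := ∫ s in Ioc r (r + 1), |deriv w s|
    have key : ∀ y ∈ Ioc r (r + 1), w r ≤ |w y| + J := by
      intro y hy
      have e := hac r y hr0 hy.1.le
      have e2 : |∫ s in r..y, deriv w s| ≤ J := by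
        refine (intervalIntegral.abs_integral_le_integral_abs hy.1.le).trans ?_
        rw [intervalIntegral.integral_of_le hy.1.le]
        apply setIntegral_mono_set id.abs
        · exact Eventually.of_forall fun x => abs_nonneg _
        · exact (HasSubset.Subset.eventuallyLE (Ioc_subset_Ioc_right hy.2))
      have e3 := neg_abs_le (∫ s in r..y, deriv w s)
      have := le_abs_self (w y)
      linarith
    have hwi : IntegrableOn w (Ioc r (r + 1)) := hw.integrableOn_Ioc
    have : w r ≤ (∫ s in Ioc r (r + 1), |w s|) + J := by
      calc w r = ∫ s in Ioc r (r + 1), w r := by simp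
        _ ≤ ∫ s in Ioc r (r + 1), (|w s| + J) := by
          apply setIntegral_mono_on (by simp) (hwi.abs.add (by simp)) measurableSet_Ioc key
        _ = _ := by rw [integral_add hwi.abs (by simp)]; simp
    calc w r ≤ E * C1 + E * C2 := by rw [hC1, hC2]; linarith
      _ = (C1 + C2) * E := by ring
      _ ≤ _ := by
        have e5 := le_abs_self (C1 + C2)
        have e6 : 0 ≤ |M| * |M2| := by positivity
        exact mul_le_mul_of_nonneg_right (by linarith) hE0.le

namespace Sol
variable {N : ℕ} {m T : ℝ} {u v vr ut : ℝ → ℝ → ℝ}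

lemma vn (h : Sol N m T u v vr ut) (r t : ℝ) : 0 ≤ v r t := by
  rw [h.veq]; exact Real.rpow_nonneg (h.un r t) _

lemma ueq (h : Sol N m T u v vr ut) (r t : ℝ) : u r t = v r t ^ (1 / m) := by
  have := h.m0
  rw [h.veq, ← Real.rpow_mul (h.un r t)]
  rw [mul_one_div_cancel this.ne', Real.rpow_one]

/-- uniform decay -/
lemma decay (h : Sol N m T u v vr ut) :
    ∃ C η α : ℝ, 0 < C ∧ 0 < η ∧ η < α ∧ 2 * α = (N:ℝ) - 1 ∧
    (∀ r, 0 ≤ r → ∀ t ∈ Ico 0 T, v r t ≤ C * Real.exp (-α * r)) ∧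
    (∀ r, 0 ≤ r → ∀ t ∈ Ico 0 T, u r t ≤ C * Real.exp (-(α + η) * r)) := by
  obtain ⟨A, hA, hini⟩ := init_decay h.hN (h.cv_r 0) (fun r => h.vn r 0) (h.h1 0 ⟨le_rfl, h.T0⟩)
  have hm0 := h.m0
  have hm1 := h.m1
  have hNr : (2:ℝ) ≤ N := by exact_mod_cast h.hN
  set α := ((N:ℝ) - 1) / 2 with hα
  have hα0 : 0 < α := by rw [hα]; linarith
  have h1m : 0 < 1 / m - 1 := by rw [sub_pos, lt_div_iff₀ hm0]; linarith
  set η := min (α * (1 / m - 1)) (α / 2) with hη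
  have hη0 : 0 < η := lt_min (by positivity) (by positivity)
  set A' := A * Real.exp (α * Real.log 2) with hA'
  have hA'0 : 0 < A' := by positivity
  have hv : ∀ r, 0 ≤ r → ∀ t ∈ Ico 0 T, v r t ≤ A' * Real.exp (-α * r) := by
    intro r hr t ht
    refine (h.decay_of_init hA hini hr ht.1 ht.2).trans ?_
    rw [hA', mul_assoc, ← Real.exp_add]
    apply mul_le_mul_of_nonneg_left _ hA.le
    apply Real.exp_le_exp.2
    have := mul_le_mul_of_nonneg_left (lc_lower r) hα0.le
    rw [← hα]
    linarith
  refine ⟨A' + A' ^ (1 / m), η, α, by positivity, hη0, ?_, by rw [hα]; ring, ?_, ?_⟩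
  · exact (min_le_right _ _).trans_lt (by linarith)
  · intro r hr t ht
    refine (hv r hr t ht).trans ?_
    apply mul_le_mul_of_nonneg_right _ (Real.exp_pos _).le
    have : 0 < A' ^ (1 / m) := by positivity
    linarith
  · intro r hr t ht
    rw [h.ueq]
    calc v r t ^ (1 / m) ≤ (A' * Real.exp (-α * r)) ^ (1 / m) :=
          Real.rpow_le_rpow (h.vn r t) (hv r hr t ht) (by positivity)
      _ = A' ^ (1 / m) * Real.exp (-α * r * (1 / m)) := by
          rw [Real.mul_rpow hA'0.le (Real.exp_pos _).le, ← Real.exp_mul]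
      _ ≤ _ := by
          apply mul_le_mul (by linarith) _ (Real.exp_pos _).le (by positivity)
          apply Real.exp_le_exp.2
          have : η ≤ α * (1 / m - 1) := min_le_left _ _
          nlinarith

end Sol

/-- mass in the ball -/
noncomputable def Ph (N : ℕ) (u : ℝ → ℝ → ℝ) (r t : ℝ) : ℝ := ∫ ρ in (0:ℝ)..r, u ρ t * Sw N ρ

lemma Sw_le_exp {N : ℕ} (hN : 2 ≤ N) {r : ℝ} (hr : 0 ≤ r) : Sw N r ≤ Real.exp (((N:ℝ) - 1) * r) := by
  unfold Sw
  have h1 : Real.sinh r ≤ Real.exp r := by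
    rw [Real.sinh_eq]; have := Real.exp_pos r; have := Real.exp_pos (-r); linarith
  refine (pow_le_pow_left₀ (Real.sinh_nonneg_iff.2 hr) h1 _).trans ?_
  rw [← Real.exp_nat_mul, Nat.cast_sub (by omega)]
  simp

lemma Sw_exp_int {N : ℕ} (hN : 2 ≤ N) {α η : ℝ} (h2 : 2 * α = (N:ℝ) - 1) (hη : η < α) {r : ℝ} (hr : 0 ≤ r) :
    ∫ ρ in (0:ℝ)..r, Real.exp (-(α + η) * ρ) * Sw N ρ ≤
      (α - η)⁻¹ * (Real.exp (-(α + η) * r) * Sw N r) := by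
  have hd : ∀ x, HasDerivAt (fun r => Real.exp (-(α + η) * r) * Sw N r)
      (Real.exp (-(α + η) * x) * (-(α + η)) * Sw N x + Real.exp (-(α + η) * x) *
        (((N:ℝ) - 1) * Real.sinh x ^ (N - 2) * Real.cosh x)) x := by
    intro x
    have h1 : HasDerivAt (fun r => Real.exp (-(α + η) * r)) (Real.exp (-(α + η) * x) * (-(α + η))) x := by
      have := ((hasDerivAt_id x).const_mul (-(α + η))).exp
      simpa using this
    exact h1.mul (Sw_deriv hN x)
  have hc : Continuous (fun x => (Real.exp (-(α + η) * x) * (-(α + η)) * Sw N x + Real.exp (-(α + η) * x) *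
        (((N:ℝ) - 1) * Real.sinh x ^ (N - 2) * Real.cosh x))) := by
    have := Sw_cont N; fun_prop
  have hf := intervalIntegral.integral_eq_sub_of_hasDerivAt (a := 0) (b := r) (fun x _ => hd x)
    (hc.intervalIntegrable _ _)
  rw [Sw_zero hN, mul_zero, sub_zero] at hf
  rw [← hf, inv_mul_eq_div, le_div_iff₀ (by linarith), mul_comm, ← intervalIntegral.integral_const_mul]
  apply intervalIntegral.integral_mono_on hr
  · apply Continuous.intervalIntegrable; have := Sw_cont N; fun_prop
  · exact hc.intervalIntegrable _ _
  · intro x hx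
    have e : Sw N x = Real.sinh x ^ (N - 2) * Real.sinh x := by
      unfold Sw; rw [← pow_succ]; congr 1; omega
    have hs : 0 ≤ Real.sinh x ^ (N - 2) := pow_nonneg (Real.sinh_nonneg_iff.2 hx.1) _
    have hsc := (Real.sinh_lt_cosh x).le
    have hE := Real.exp_pos (-(α + η) * x)
    rw [← h2, e]
    have hα : 0 ≤ 2 * α := by
      rw [h2]; have : (2:ℝ) ≤ N := by exact_mod_cast hN
      linarith
    have := mul_le_mul_of_nonneg_left hsc (mul_nonneg (mul_nonneg hE.le hs) hα)
    nlinarith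

namespace Sol
variable {N : ℕ} {m T : ℝ} {u v vr ut : ℝ → ℝ → ℝ}

lemma ph_zero (t : ℝ) : Ph N u 0 t = 0 := by simp [Ph]

lemma ph_cont (h : Sol N m T u v vr ut) : Continuous (fun p : ℝ × ℝ => Ph N u p.1 p.2) := by
  unfold Ph
  have hc := h.cu
  have hS := Sw_cont N
  apply intervalIntegral.continuous_parametric_intervalIntegral_of_continuous
    (f := fun (p : ℝ × ℝ) ρ => u ρ p.2 * Sw N ρ) (s := fun p : ℝ × ℝ => p.1)
  · have : Continuous (fun q : (ℝ × ℝ) × ℝ => u q.2 q.1.2) :=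
      hc.comp (f := fun q : (ℝ × ℝ) × ℝ => (q.2, q.1.2)) (by fun_prop)
    exact this.mul (hS.comp continuous_snd)
  · fun_prop

lemma ph_dr (h : Sol N m T u v vr ut) (r t : ℝ) :
    HasDerivAt (fun r => Ph N u r t) (u r t * Sw N r) r := by
  have hc : Continuous (fun ρ => u ρ t * Sw N ρ) := (h.cu_r t).mul (Sw_cont N)
  exact intervalIntegral.integral_hasDerivAt_right (hc.intervalIntegrable _ _)
    (hc.stronglyMeasurableAtFilter _ _) hc.continuousAt

lemma ph_dt (h : Sol N m T u v vr ut) {r t : ℝ} (hr : 0 ≤ r) (ht : t ∈ Ioo 0 T) :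
    HasDerivAt (fun t => Ph N u r t) (Sw N r * vr r t) t := by
  obtain ⟨δ, hδ, hsub⟩ := Metric.isOpen_iff.1 isOpen_Ioo t ht
  have hK : Icc 0 r ×ˢ Metric.closedBall t (δ / 2) ⊆ Ici 0 ×ˢ Ioo 0 T := by
    rintro ⟨x, y⟩ ⟨hx, hy⟩
    exact ⟨hx.1, hsub (Metric.closedBall_subset_ball (by linarith) hy)⟩
  have hKc : IsCompact (Icc 0 r ×ˢ Metric.closedBall t (δ / 2)) :=
    isCompact_Icc.prod (isCompact_closedBall _ _)
  obtain ⟨B, hB⟩ := hKc.exists_bound_of_continuousOn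
    (f := fun p : ℝ × ℝ => ut p.1 p.2 * Sw N p.1)
    ((h.cut.mono hK).mul ((Sw_cont N).comp continuous_fst).continuousOn)
  rw [← h.flux hr ht]
  have e : ∫ ρ in (0:ℝ)..r, Sw N ρ * ut ρ t = ∫ ρ in (0:ℝ)..r, ut ρ t * Sw N ρ := by
    congr 1; funext x; ring
  rw [e]
  unfold Ph
  refine (intervalIntegral.hasDerivAt_integral_of_dominated_loc_of_deriv_le
    (F := fun t ρ => u ρ t * Sw N ρ) (F' := fun t ρ => ut ρ t * Sw N ρ) (bound := fun _ => B)
    (s := Metric.ball t (δ / 2)) (Metric.ball_mem_nhds _ (by linarith)) ?_ ?_ ?_ ?_ ?_ ?_).2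
  · exact Eventually.of_forall fun s => ((h.cu_r s).mul (Sw_cont N)).aestronglyMeasurable
  · exact ((h.cu_r t).mul (Sw_cont N)).intervalIntegrable _ _
  · rw [uIoc_of_le hr]
    refine ContinuousOn.aestronglyMeasurable ?_ measurableSet_Ioc
    exact (((h.cut_r ht).mono (fun x hx => hx.1.le)).mul (Sw_cont N).continuousOn)
  · refine Eventually.of_forall fun x hx s hs => ?_
    rw [uIoc_of_le hr] at hx
    exact hB (x, s) ⟨Ioc_subset_Icc_self hx, Metric.ball_subset_closedBall hs⟩
  · exact intervalIntegrable_const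
  · refine Eventually.of_forall fun x hx s hs => ?_
    rw [uIoc_of_le hr] at hx
    have h9 : ((x, s) : ℝ × ℝ) ∈ Ici 0 ×ˢ Ioo 0 T :=
      hK ⟨Ioc_subset_Icc_self hx, Metric.ball_subset_closedBall hs⟩
    exact (h.du x hx.1.le s h9.2).mul_const _

lemma ph_bound (h : Sol N m T u v vr ut) : ∃ C η : ℝ, 0 < C ∧ 0 < η ∧
    (∀ r, 0 ≤ r → ∀ t ∈ Ico 0 T, ∀ a ∈ Ico 0 T,
      (Ph N u r t - Ph N u r a) ^ 2 ≤ C * Real.exp (-η * r) * Sw N r) ∧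
    (∀ r, 0 ≤ r → ∀ t ∈ Ico 0 T, ∀ a ∈ Ico 0 T, ∀ t' ∈ Ico 0 T, ∀ a' ∈ Ico 0 T,
      |Ph N u r t - Ph N u r a| * |v r t' - v r a'| ≤ C * Real.exp (-η * r)) ∧
    (∀ r, 0 ≤ r → ∀ t ∈ Ico 0 T, u r t ^ (m + 1) * Sw N r ≤ C * Real.exp (-η * r)) := by
  obtain ⟨C, η, α, hC, hη, hηα, h2, hv, hu⟩ := h.decay
  have hκ : 0 < α - η := by linarith
  have hph : ∀ r, 0 ≤ r → ∀ t ∈ Ico 0 T, 0 ≤ Ph N u r t ∧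
      Ph N u r t ≤ C * ((α - η)⁻¹ * (Real.exp (-(α + η) * r) * Sw N r)) := by
    intro r hr t ht
    constructor
    · exact intervalIntegral.integral_nonneg hr (fun x hx => mul_nonneg (h.un _ _) (Sw_nonneg N hx.1))
    · refine le_trans ?_ (mul_le_mul_of_nonneg_left (Sw_exp_int h.hN h2 hηα hr) hC.le)
      rw [← intervalIntegral.integral_const_mul]
      apply intervalIntegral.integral_mono_on hr
      · exact ((h.cu_r t).mul (Sw_cont N)).intervalIntegrable _ _
      · apply Continuous.intervalIntegrable; have := Sw_cont N; fun_prop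
      · intro x hx
        have := mul_le_mul_of_nonneg_right (hu x hx.1 t ht) (Sw_nonneg N hx.1)
        linarith
  set κ := C * (α - η)⁻¹ with hκd
  have hκ0 : 0 < κ := by positivity
  have hphd : ∀ r, 0 ≤ r → ∀ t ∈ Ico 0 T, ∀ a ∈ Ico 0 T,
      |Ph N u r t - Ph N u r a| ≤ κ * (Real.exp (-(α + η) * r) * Sw N r) := by
    intro r hr t ht a ha
    have h3 := hph r hr t ht
    have h4 := hph r hr a ha
    rw [abs_le]; constructor <;> rw [hκd, mul_assoc] <;> linarith
  have hSe : ∀ r, 0 ≤ r → Real.exp (-α * r) * (Real.exp (-α * r) * Sw N r) ≤ 1 := by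
    intro r hr
    have := Sw_le_exp h.hN hr
    rw [← h2] at this
    calc Real.exp (-α * r) * (Real.exp (-α * r) * Sw N r) ≤
        Real.exp (-α * r) * (Real.exp (-α * r) * Real.exp (2 * α * r)) := by gcongr
      _ = 1 := by rw [← Real.exp_add, ← Real.exp_add, Real.exp_eq_one_iff]; ring
  have hE : ∀ r, Real.exp (-(α + η) * r) = Real.exp (-α * r) * Real.exp (-η * r) := by
    intro r; rw [← Real.exp_add]; ring_nf
  refine ⟨κ ^ 2 + κ * C + C * C, η, by positivity, hη, ?_, ?_, ?_⟩
  · intro r hr t ht a ha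
    have h3 := hphd r hr t ht a ha
    have hS := Sw_nonneg N hr
    have he1 : Real.exp (-η * r) ≤ 1 := Real.exp_le_one_iff.2 (by nlinarith)
    have he := Real.exp_pos (-η * r)
    rw [← sq_abs]
    calc |Ph N u r t - Ph N u r a| ^ 2 ≤ (κ * (Real.exp (-(α + η) * r) * Sw N r)) ^ 2 :=
          pow_le_pow_left₀ (abs_nonneg _) h3 2
      _ = κ ^ 2 * ((Real.exp (-α * r) * (Real.exp (-α * r) * Sw N r)) * (Real.exp (-η * r) * Real.exp (-η * r)) * Sw N r) := by
          rw [hE]; ring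
      _ ≤ κ ^ 2 * (1 * (Real.exp (-η * r) * 1) * Sw N r) := by
          gcongr
          exact hSe r hr
      _ ≤ _ := by
          have : 0 ≤ (κ * C + C * C) * (Real.exp (-η * r) * Sw N r) := by positivity
          nlinarith
  · intro r hr t ht a ha t' ht' a' ha'
    have h3 := hphd r hr t ht a ha
    have hS := Sw_nonneg N hr
    have he := Real.exp_pos (-η * r)
    have h4 : |v r t' - v r a'| ≤ C * Real.exp (-α * r) := by
      have := hv r hr t' ht'
      have := hv r hr a' ha'
      have := h.vn r t'
      have := h.vn r a'
      rw [abs_le]; constructor <;> linarith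
    calc |Ph N u r t - Ph N u r a| * |v r t' - v r a'| ≤
        (κ * (Real.exp (-(α + η) * r) * Sw N r)) * (C * Real.exp (-α * r)) := by gcongr
      _ = κ * C * ((Real.exp (-α * r) * (Real.exp (-α * r) * Sw N r)) * Real.exp (-η * r)) := by
          rw [hE]; ring
      _ ≤ κ * C * (1 * Real.exp (-η * r)) := by
          gcongr
          exact hSe r hr
      _ ≤ _ := by
          have : 0 ≤ (κ ^ 2 + C * C) * Real.exp (-η * r) := by positivity
          nlinarith
  · intro r hr t ht
    have hS := Sw_nonneg N hr
    have he := Real.exp_pos (-η * r)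
    have e : u r t ^ (m + 1) = v r t * u r t := by
      rw [h.veq]
      rcases (h.un r t).eq_or_lt with h0 | h0
      · rw [← h0, Real.zero_rpow (by linarith [h.m0])]; simp
      · rw [Real.rpow_add_one h0.ne']
    rw [e]
    calc v r t * u r t * Sw N r ≤ (C * Real.exp (-α * r)) * (C * Real.exp (-(α + η) * r)) * Sw N r := by
          apply mul_le_mul_of_nonneg_right _ hS
          exact mul_le_mul (hv r hr t ht) (hu r hr t ht) (h.un _ _) (by positivity)
      _ = C * C * ((Real.exp (-α * r) * (Real.exp (-α * r) * Sw N r)) * Real.exp (-η * r)) := by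
          rw [hE]; ring
      _ ≤ C * C * (1 * Real.exp (-η * r)) := by
          gcongr
          exact hSe r hr
      _ ≤ _ := by
          have : 0 ≤ (κ ^ 2 + κ * C) * Real.exp (-η * r) := by positivity
          nlinarith

end Sol

lemma genA_cont {N : ℕ} {Ψ : ℝ → ℝ → ℝ} (hΨ : Continuous (fun p : ℝ × ℝ => Ψ p.1 p.2))
    {a b C R : ℝ} (hR : 0 ≤ R)
    (hb : ∀ r, 0 ≤ r → ∀ t ∈ Icc a b, Ψ r t ^ 2 ≤ C * Sw N r) :
    ContinuousOn (fun t => ∫ r in (0:ℝ)..R, Ψ r t ^ 2 / (2 * Sw N r)) (Icc a b) := by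
  intro t ht
  have cr : ∀ t, Continuous (fun r => Ψ r t) := fun t =>
    hΨ.comp (f := fun r : ℝ => ((r, t) : ℝ × ℝ)) (by fun_prop)
  have ct : ∀ r, Continuous (fun t => Ψ r t) := fun r =>
    hΨ.comp (f := fun t : ℝ => ((r, t) : ℝ × ℝ)) (by fun_prop)
  apply intervalIntegral.continuousWithinAt_of_dominated_interval (bound := fun _ => C / 2)
  · refine Eventually.of_forall fun s => ?_
    exact (((cr s).pow 2).measurable.div ((Sw_cont N).measurable.const_mul 2)).aestronglyMeasurable
  · filter_upwards [self_mem_nhdsWithin] with s hs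
    refine Eventually.of_forall fun x hx => ?_
    rw [uIoc_of_le hR] at hx
    have hS := Sw_pos N hx.1
    rw [Real.norm_of_nonneg (by positivity), div_le_iff₀ (by positivity)]
    have := hb x hx.1.le s hs
    linarith
  · exact intervalIntegrable_const
  · refine Eventually.of_forall fun x hx => ?_
    exact (((ct x).pow 2).div_const _).continuousWithinAt

lemma genA_meas {N : ℕ} {Ψ : ℝ → ℝ → ℝ} (hΨ : Continuous (fun p : ℝ × ℝ => Ψ p.1 p.2))
    {C R t : ℝ} (hR : 0 ≤ R)
    (hb : ∀ r, 0 ≤ r → Ψ r t ^ 2 ≤ C * Sw N r) :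
    IntervalIntegrable (fun r => Ψ r t ^ 2 / (2 * Sw N r)) volume 0 R := by
  have cr : ∀ t, Continuous (fun r => Ψ r t) := fun t =>
    hΨ.comp (f := fun r : ℝ => ((r, t) : ℝ × ℝ)) (by fun_prop)
  refine (intervalIntegrable_const (c := C / 2)).mono_fun
    (((cr t).pow 2).measurable.div ((Sw_cont N).measurable.const_mul 2)).aestronglyMeasurable ?_
  filter_upwards [ae_restrict_mem measurableSet_uIoc] with x hx
  rw [uIoc_of_le hR] at hx
  have hS := Sw_pos N hx.1
  refine le_trans ?_ (le_abs_self _)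
  rw [Real.norm_of_nonneg (by positivity), div_le_iff₀ (by positivity)]
  have := hb x hx.1.le
  linarith

lemma genA_deriv {N : ℕ} {Ψ z : ℝ → ℝ → ℝ} (hΨ : Continuous (fun p : ℝ × ℝ => Ψ p.1 p.2))
    {a b C R : ℝ} (hR : 0 ≤ R)
    (hb : ∀ r, 0 ≤ r → ∀ t ∈ Icc a b, Ψ r t ^ 2 ≤ C * Sw N r)
    (hz : ContinuousOn (fun p : ℝ × ℝ => z p.1 p.2) (Ici 0 ×ˢ Ioo a b))
    (hd : ∀ r, 0 < r → ∀ t ∈ Ioo a b, HasDerivAt (fun t => Ψ r t) (Sw N r * z r t) t)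
    {t : ℝ} (ht : t ∈ Ioo a b) :
    HasDerivAt (fun t => ∫ r in (0:ℝ)..R, Ψ r t ^ 2 / (2 * Sw N r))
      (∫ r in (0:ℝ)..R, Ψ r t * z r t) t := by
  have cr : ∀ t, Continuous (fun r => Ψ r t) := fun t =>
    hΨ.comp (f := fun r : ℝ => ((r, t) : ℝ × ℝ)) (by fun_prop)
  obtain ⟨δ, hδ, hsub⟩ := Metric.isOpen_iff.1 isOpen_Ioo t ht
  have hK : Icc 0 R ×ˢ Metric.closedBall t (δ / 2) ⊆ Ici 0 ×ˢ Ioo a b := by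
    rintro ⟨x, y⟩ ⟨hx, hy⟩
    exact ⟨hx.1, hsub (Metric.closedBall_subset_ball (by linarith) hy)⟩
  have hKc : IsCompact (Icc 0 R ×ˢ Metric.closedBall t (δ / 2)) :=
    isCompact_Icc.prod (isCompact_closedBall _ _)
  obtain ⟨B, hB⟩ := hKc.exists_bound_of_continuousOn
    (f := fun p : ℝ × ℝ => Ψ p.1 p.2 * z p.1 p.2)
    (hΨ.continuousOn.mul (hz.mono hK))
  refine (intervalIntegral.hasDerivAt_integral_of_dominated_loc_of_deriv_le
    (F := fun t r => Ψ r t ^ 2 / (2 * Sw N r)) (F' := fun t r => Ψ r t * z r t) (bound := fun _ => B)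
    (s := Metric.ball t (δ / 2)) (Metric.ball_mem_nhds _ (by linarith)) ?_ ?_ ?_ ?_ ?_ ?_).2
  · exact Eventually.of_forall fun s =>
      (((cr s).pow 2).measurable.div ((Sw_cont N).measurable.const_mul 2)).aestronglyMeasurable
  · exact genA_meas hΨ hR (fun r hr => hb r hr t (Ioo_subset_Icc_self ht))
  · rw [uIoc_of_le hR]
    refine ContinuousOn.aestronglyMeasurable ?_ measurableSet_Ioc
    refine (cr t).continuousOn.mul ?_
    exact hz.comp (f := fun r : ℝ => ((r, t) : ℝ × ℝ)) (by fun_prop) (fun r hr => ⟨hr.1.le, ht⟩)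
  · refine Eventually.of_forall fun x hx s hs => ?_
    rw [uIoc_of_le hR] at hx
    exact hB (x, s) ⟨Ioc_subset_Icc_self hx, Metric.ball_subset_closedBall hs⟩
  · exact intervalIntegrable_const
  · refine Eventually.of_forall fun x hx s hs => ?_
    rw [uIoc_of_le hR] at hx
    have h9 : ((x, s) : ℝ × ℝ) ∈ Ici 0 ×ˢ Ioo a b :=
      hK ⟨Ioc_subset_Icc_self hx, Metric.ball_subset_closedBall hs⟩
    have hS := Sw_pos N hx.1
    refine (((hd x hx.1 s h9.2).pow 2).div_const (2 * Sw N x)).congr_deriv ?_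
    field_simp
    ring

/-- integration by parts with an absolutely continuous function -/
lemma ibp_ac {N : ℕ} {w P p : ℝ → ℝ} {R C : ℝ} (hN : 2 ≤ N) (hR : 0 < R) (hw : Continuous w)
    (h1 : MemH1rad N w) (hp : Continuous p) (hP : ∀ r, HasDerivAt P (p r * Sw N r) r) (hP0 : P 0 = 0)
    (hb : ∀ r, 0 ≤ r → P r ^ 2 ≤ C * Sw N r) :
    IntervalIntegrable (fun r => P r * deriv w r) volume 0 R ∧
    ∫ r in (0:ℝ)..R, P r * deriv w r = P R * w R - ∫ r in (0:ℝ)..R, p r * Sw N r * w r := by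
  obtain ⟨hac, hi1, hi2⟩ := h1
  have hPc : Continuous P := continuous_iff_continuousAt.2 fun r => (hP r).continuousAt
  have hmd : Measurable (deriv w) := measurable_deriv w
  have hint : IntervalIntegrable (fun r => P r * deriv w r) volume 0 R := by
    rw [intervalIntegrable_iff_integrableOn_Ioc_of_le hR.le]
    have g : IntegrableOn (fun r => C / 2 + 1 / 2 * (deriv w r ^ 2 * Real.sinh r ^ (N - 1))) (Ioc 0 R) := by
      apply Integrable.add
      · simp
      · exact (hi2.mono_set (fun x hx => hx.1)).const_mul _
    refine g.mono' (hPc.measurable.mul hmd).aestronglyMeasurable ?_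
    filter_upwards [ae_restrict_mem measurableSet_Ioc] with x hx
    have hS := Sw_pos N hx.1
    have := hb x hx.1.le
    show |P x * deriv w x| ≤ C / 2 + 1 / 2 * (deriv w x ^ 2 * Sw N x)
    have h3 : P x ^ 2 / Sw N x ≤ C := by rw [div_le_iff₀ hS]; exact this
    have h4 : P x * deriv w x = (P x / √(Sw N x)) * (√(Sw N x) * deriv w x) := by
      field_simp
    have h5 : (P x / √(Sw N x)) ^ 2 = P x ^ 2 / Sw N x := by
      rw [div_pow, Real.sq_sqrt hS.le]
    have h6 : (√(Sw N x) * deriv w x) ^ 2 = Sw N x * deriv w x ^ 2 := by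
      rw [mul_pow, Real.sq_sqrt hS.le]
    rw [h4, abs_le]
    constructor <;> nlinarith [sq_nonneg (P x / √(Sw N x) + (√(Sw N x) * deriv w x)), sq_nonneg (P x / √(Sw N x) - (√(Sw N x) * deriv w x))]
  refine ⟨hint, ?_⟩
  have hps : Continuous (fun r => p r * Sw N r) := hp.mul (Sw_cont N)
  -- on [ε,R]
  have key : ∀ ε ∈ Ioo 0 R, ∫ r in ε..R, P r * deriv w r = P R * w R - P ε * w ε - ∫ r in ε..R, p r * Sw N r * w r := by
    intro ε hε
    have hw2 := intOn_of_sq hmd (sq_intOn (N := N) (f := deriv w) hmd hi2 hε.1 (b := R))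
    have hwi : IntervalIntegrable (deriv w) volume ε R := by
      rwa [intervalIntegrable_iff_integrableOn_Ioc_of_le hε.2.le]
    have acw : AbsolutelyContinuousOnInterval w ε R := by
      have a1 := hwi.absolutelyContinuousOnInterval_intervalIntegral (c := ε) (by simp)
      have a2 : AbsolutelyContinuousOnInterval (fun _ : ℝ => w ε) ε R :=
        contDiffOn_const.absolutelyContinuousOnInterval
      have a3 := a2.add a1
      have hcg : ∀ x ∈ uIcc ε R, w x = ((fun _ : ℝ => w ε) + fun x => ∫ (s : ℝ) in ε..x, deriv w s) x := by
        intro x hx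
        rw [uIcc_of_le hε.2.le] at hx
        have := hac ε x hε.1 hx.1
        simp only [Pi.add_apply]; linarith
      rw [absolutelyContinuousOnInterval_iff] at a3 ⊢
      intro e he
      obtain ⟨δ, hδ, hh⟩ := a3 e he
      refine ⟨δ, hδ, fun E hE h2 => ?_⟩
      refine lt_of_eq_of_lt ?_ (hh E hE h2)
      refine Finset.sum_congr rfl fun i hi => ?_
      rw [hcg _ (hE.1 i hi).1, hcg _ (hE.1 i hi).2]
    have acP : AbsolutelyContinuousOnInterval P ε R := by
      have : ContDiff ℝ 1 P := by
        rw [contDiff_one_iff_deriv]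
        refine ⟨fun x => (hP x).differentiableAt, ?_⟩
        have : deriv P = fun r => p r * Sw N r := by funext x; exact (hP x).deriv
        rw [this]; exact hps
      exact this.contDiffOn.absolutelyContinuousOnInterval
    rw [acP.integral_mul_deriv_eq_deriv_mul acw]
    congr 2
    funext x
    rw [(hP x).deriv]
  have hint2 : IntervalIntegrable (fun r => p r * Sw N r * w r) volume 0 R :=
    (hps.mul hw).intervalIntegrable _ _
  have hne : (𝓝[>] (0:ℝ)).NeBot := inferInstance
  have lim : ∀ f : ℝ → ℝ, IntervalIntegrable f volume 0 R →
      Tendsto (fun ε => ∫ r in ε..R, f r) (𝓝[>] 0) (𝓝 (∫ r in (0:ℝ)..R, f r)) := by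
    intro f hf
    have hc := intervalIntegral.continuousOn_primitive_interval_left (f := f) (a := 0) (b := R) (μ := volume)
      (by rw [uIcc_of_le hR.le, integrableOn_Icc_iff_integrableOn_Ioc]; rwa [intervalIntegrable_iff_integrableOn_Ioc_of_le hR.le] at hf)
    rw [uIcc_of_le hR.le] at hc
    have := hc 0 ⟨le_rfl, hR.le⟩
    have h2 := this.tendsto
    refine h2.mono_left ?_
    rw [← nhdsWithin_Ioo_eq_nhdsGT hR]
    exact nhdsWithin_mono _ Ioo_subset_Icc_self
  have l1 := lim _ hint
  have l2 : Tendsto (fun ε => P R * w R - P ε * w ε - ∫ r in ε..R, p r * Sw N r * w r) (𝓝[>] 0)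
      (𝓝 (P R * w R - P 0 * w 0 - ∫ r in (0:ℝ)..R, p r * Sw N r * w r)) := by
    refine Tendsto.sub (tendsto_const_nhds.sub ?_) (lim _ hint2)
    exact ((hPc.mul hw).tendsto 0).mono_left nhdsWithin_le_nhds
  have l3 := l2.congr' (f₂ := fun ε => ∫ r in ε..R, P r * deriv w r) (by
    filter_upwards [Ioo_mem_nhdsGT hR] with ε hε
    exact (key ε hε).symm)
  have := tendsto_nhds_unique l1 l3
  rw [this, hP0]; ring

/-- Dirichlet energy -/
noncomputable def Gr (N : ℕ) (v : ℝ → ℝ → ℝ) (t : ℝ) : ℝ :=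
  ∫ r in Ioi (0:ℝ), 1 / 2 * (deriv (fun ρ => v ρ t) r) ^ 2 * Sw N r

namespace Sol
variable {N : ℕ} {m T : ℝ} {u v vr ut : ℝ → ℝ → ℝ}

lemma gr_int (h : Sol N m T u v vr ut) {a : ℝ} (ha : a ∈ Ico 0 T) :
    IntegrableOn (fun r => 1 / 2 * (deriv (fun ρ => v ρ a) r) ^ 2 * Sw N r) (Ioi 0) := by
  have := ((h.h1 a ha).2.2).const_mul (1 / 2)
  refine this.congr (Eventually.of_forall fun x => ?_)
  simp only [Sw]; ring

lemma gr_nonneg (v : ℝ → ℝ → ℝ) (a : ℝ) : 0 ≤ Gr N v a := by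
  apply setIntegral_nonneg measurableSet_Ioi
  intro x hx
  have := Sw_nonneg N (le_of_lt hx)
  positivity

lemma mono_uv (h : Sol N m T u v vr ut) (r s t : ℝ) : 0 ≤ (u r s - u r t) * (v r s - v r t) := by
  rw [h.veq, h.veq]
  have hm := h.m0
  rcases le_total (u r s) (u r t) with h1 | h1
  · have := Real.rpow_le_rpow (h.un _ _) h1 hm.le
    nlinarith
  · have := Real.rpow_le_rpow (h.un _ _) h1 hm.le
    nlinarith

lemma W_mono {Ψ : ℝ → ℝ → ℝ} (hΨ : Continuous (fun p : ℝ × ℝ => Ψ p.1 p.2))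
    {C R R' t : ℝ} (hR : 0 ≤ R) (hRR : R ≤ R')
    (hb : ∀ r, 0 ≤ r → Ψ r t ^ 2 ≤ C * Sw N r) :
    ∫ r in (0:ℝ)..R, Ψ r t ^ 2 / (2 * Sw N r) ≤ ∫ r in (0:ℝ)..R', Ψ r t ^ 2 / (2 * Sw N r) := by
  have i := genA_meas hΨ (hR.trans hRR) hb
  rw [intervalIntegral.integral_of_le hR, intervalIntegral.integral_of_le (hR.trans hRR)]
  rw [intervalIntegrable_iff_integrableOn_Ioc_of_le (hR.trans hRR)] at i
  apply setIntegral_mono_set i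
  · filter_upwards [ae_restrict_mem measurableSet_Ioc] with x hx
    have := Sw_nonneg N hx.1.le
    show 0 ≤ Ψ x t ^ 2 / (2 * Sw N x)
    positivity
  · exact LE.le.eventuallyLE (Ioc_subset_Ioc_right hRR)

lemma step1_aux (h : Sol N m T u v vr ut) {C η : ℝ} (hC : 0 < C)
    (b1 : ∀ r, 0 ≤ r → ∀ t ∈ Ico 0 T, ∀ a ∈ Ico 0 T,
      (Ph N u r t - Ph N u r a) ^ 2 ≤ C * Real.exp (-η * r) * Sw N r)
    (b1' : ∀ r, 0 ≤ r → ∀ t ∈ Ico 0 T, ∀ a ∈ Ico 0 T,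
      (Ph N u r t - Ph N u r a) ^ 2 ≤ C * Sw N r)
    (b2 : ∀ r, 0 ≤ r → ∀ t ∈ Ico 0 T, ∀ a ∈ Ico 0 T, ∀ t' ∈ Ico 0 T, ∀ a' ∈ Ico 0 T,
      |Ph N u r t - Ph N u r a| * |v r t' - v r a'| ≤ C * Real.exp (-η * r))
    {a b R ε : ℝ} (ha : a ∈ Ico 0 T) (hab : a < b) (hb : b < T) (hR : 0 < R) (hε : 0 < ε) :
    ∫ r in (0:ℝ)..R, (Ph N u r b - Ph N u r a) ^ 2 / (2 * Sw N r) ≤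
      (ε + (b - a)) * ((b - a) * (Gr N v a + C * Real.exp (-η * R) / ε)) := by
  set Ψ : ℝ → ℝ → ℝ := fun r t => Ph N u r t - Ph N u r a with hΨd
  have hpc := h.ph_cont
  have hΨ : Continuous (fun p : ℝ × ℝ => Ψ p.1 p.2) := by
    refine hpc.sub ?_
    exact hpc.comp (f := fun p : ℝ × ℝ => ((p.1, a) : ℝ × ℝ)) (by fun_prop)
  have sub : Icc a b ⊆ Ico 0 T := fun x hx => ⟨ha.1.trans hx.1, hx.2.trans_lt hb⟩
  have sub2 : Ioo a b ⊆ Ioo 0 T := fun x hx => ⟨ha.1.trans_lt hx.1, hx.2.trans hb⟩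
  have hbd : ∀ r, 0 ≤ r → ∀ t ∈ Icc a b, Ψ r t ^ 2 ≤ C * Sw N r :=
    fun r hr t ht => b1' r hr t (sub ht) a ha
  set W : ℝ → ℝ := fun t => ∫ r in (0:ℝ)..R, Ψ r t ^ 2 / (2 * Sw N r) with hW
  have hWc : ContinuousOn W (Icc a b) := genA_cont hΨ hR.le hbd
  have hWd : ∀ t ∈ Ioo a b, HasDerivAt W (∫ r in (0:ℝ)..R, Ψ r t * vr r t) t := by
    intro t ht
    refine genA_deriv hΨ hR.le hbd (h.cvr.mono (prod_mono_right sub2)) ?_ ht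
    intro r hr s hs
    exact (h.ph_dt hr.le (sub2 hs)).sub_const _
  set K := Gr N v a + C * Real.exp (-η * R) / ε with hK
  have hanti : AntitoneOn (fun t => W t / (ε + (t - a)) - t * K) (Icc a b) := by
    have hd : ∀ t ∈ Ioo a b, HasDerivAt (fun t => W t / (ε + (t - a)) - t * K)
        (((∫ r in (0:ℝ)..R, Ψ r t * vr r t) * (ε + (t - a)) - W t * 1) / (ε + (t - a)) ^ 2 - 1 * K) t := by
      intro t ht
      have hq : 0 < ε + (t - a) := by linarith [ht.1]
      exact ((hWd t ht).div (((hasDerivAt_id t).sub_const a).const_add ε) hq.ne').sub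
        ((hasDerivAt_id t).mul_const K)
    apply antitoneOn_of_deriv_nonpos (convex_Icc a b)
    · refine ContinuousOn.sub (hWc.div (by fun_prop) ?_) (by fun_prop)
      intro x hx; linarith [hx.1]
    · rw [interior_Icc]
      exact fun t ht => (hd t ht).differentiableAt.differentiableWithinAt
    · rw [interior_Icc]
      intro t ht
      rw [(hd t ht).deriv]
      have ht' := sub2 ht
      have htI : t ∈ Ico 0 T := Ioo_subset_Ico_self ht'
      have hq : 0 < ε + (t - a) := by linarith [ht.1]
      set q := ε + (t - a) with hqd
      -- spatial
      have hPd : ∀ r, HasDerivAt (fun r => Ψ r t) ((u r t - u r a) * Sw N r) r := by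
        intro r
        refine ((h.ph_dr r t).sub (h.ph_dr r a)).congr_deriv ?_
        ring
      have hP0 : Ψ 0 t = 0 := by simp [hΨd, Ph]
      have hPc : Continuous (fun r => Ψ r t) := continuous_iff_continuousAt.2 fun r => (hPd r).continuousAt
      have cuu : Continuous (fun r => u r t - u r a) := (h.cu_r t).sub (h.cu_r a)
      have I1 : ∫ r in (0:ℝ)..R, Ψ r t * vr r t = Ψ R t * v R t - ∫ r in (0:ℝ)..R, (u r t - u r a) * Sw N r * v r t := by
        have := intervalIntegral.integral_mul_deriv_eq_deriv_mul_of_hasDerivAt (a := 0) (b := R)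
          (u := fun r => Ψ r t) (v := fun r => v r t) (u' := fun r => (u r t - u r a) * Sw N r)
          (v' := fun r => vr r t) hPc.continuousOn (h.cv_r t).continuousOn
          (fun x _ => hPd x)
          (fun x hx => h.dv x (by rw [min_eq_left hR.le] at hx; exact hx.1) t ht')
          ((cuu.mul (Sw_cont N)).intervalIntegrable _ _)
          (((h.cvr_r ht').mono Icc_subset_Ici_self).intervalIntegrable_of_Icc hR.le)
        rw [this, hP0]; ring
      obtain ⟨Iint, I2⟩ := ibp_ac h.hN hR (h.cv_r a) (h.h1 a ha) cuu hPd hP0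
        (fun r hr => hbd r hr t (Ioo_subset_Icc_self ht))
      have I3 : 0 ≤ (∫ r in (0:ℝ)..R, (u r t - u r a) * Sw N r * v r t) -
          ∫ r in (0:ℝ)..R, (u r t - u r a) * Sw N r * v r a := by
        rw [← intervalIntegral.integral_sub]
        · apply intervalIntegral.integral_nonneg hR.le
          intro x hx
          have h1 := h.mono_uv x t a
          have h2 := Sw_nonneg N hx.1
          have := mul_nonneg h1 h2
          nlinarith
        · exact ((cuu.mul (Sw_cont N)).mul (h.cv_r t)).intervalIntegrable _ _
        · exact ((cuu.mul (Sw_cont N)).mul (h.cv_r a)).intervalIntegrable _ _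
      have I4 : Ψ R t * v R t - Ψ R t * v R a ≤ C * Real.exp (-η * R) := by
        have := b2 R hR.le t htI a ha t htI a ha
        rw [← abs_mul] at this
        have h2 := (le_abs_self _).trans this
        simp only [hΨd]; linarith
      have I5 : (∫ r in (0:ℝ)..R, Ψ r t * deriv (fun ρ => v ρ a) r) / q - W t / q ^ 2 ≤ Gr N v a := by
        rw [hW]
        have iw := genA_meas hΨ hR.le (fun r hr => hbd r hr t (Ioo_subset_Icc_self ht))
        rw [← intervalIntegral.integral_div, ← intervalIntegral.integral_div,
          ← intervalIntegral.integral_sub (Iint.div_const _) (iw.div_const _)]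
        have ig := h.gr_int ha
        have ig2 : IntervalIntegrable (fun r => 1 / 2 * (deriv (fun ρ => v ρ a) r) ^ 2 * Sw N r) volume 0 R := by
          rw [intervalIntegrable_iff_integrableOn_Ioc_of_le hR.le]
          exact ig.mono_set (fun x hx => hx.1)
        calc _ ≤ ∫ r in (0:ℝ)..R, 1 / 2 * (deriv (fun ρ => v ρ a) r) ^ 2 * Sw N r := by
              apply intervalIntegral.integral_mono_on_of_le_Ioo hR.le ((Iint.div_const _).sub (iw.div_const _)) ig2
              intro x hx
              have hS := Sw_pos N hx.1
              set d := deriv (fun ρ => v ρ a) x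
              have : 1 / 2 * d ^ 2 * Sw N x - (Ψ x t * d / q - Ψ x t ^ 2 / (2 * Sw N x) / q ^ 2) =
                (1 / (2 * Sw N x)) * (d * Sw N x - Ψ x t / q) ^ 2 := by
                field_simp; ring
              have h2 : 0 ≤ (1 / (2 * Sw N x)) * (d * Sw N x - Ψ x t / q) ^ 2 := by positivity
              linarith
          _ ≤ Gr N v a := by
              rw [intervalIntegral.integral_of_le hR.le]
              apply setIntegral_mono_set ig
              · filter_upwards [ae_restrict_mem measurableSet_Ioi] with x hx
                have := Sw_nonneg N (le_of_lt hx)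
                show 0 ≤ 1 / 2 * (deriv (fun ρ => v ρ a) x) ^ 2 * Sw N x
                positivity
              · exact LE.le.eventuallyLE (fun x hx => hx.1)
      have I6 : (∫ r in (0:ℝ)..R, Ψ r t * vr r t) ≤ C * Real.exp (-η * R) +
          ∫ r in (0:ℝ)..R, Ψ r t * deriv (fun ρ => v ρ a) r := by
        rw [I1, I2]; linarith
      have I7 : C * Real.exp (-η * R) / q ≤ C * Real.exp (-η * R) / ε := by
        apply div_le_div_of_nonneg_left (by positivity) hε
        linarith [ht.1]
      have I8 : ((∫ r in (0:ℝ)..R, Ψ r t * vr r t) * q - W t * 1) / q ^ 2 =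
          (∫ r in (0:ℝ)..R, Ψ r t * vr r t) / q - W t / q ^ 2 := by
        field_simp
      rw [I8]
      have I9 := div_le_div_of_nonneg_right I6 hq.le
      rw [add_div] at I9
      rw [hK]; linarith
  have hfin := hanti (left_mem_Icc.2 hab.le) (right_mem_Icc.2 hab.le) hab.le
  have hWa : W a = 0 := by simp [hW, hΨd]
  simp only [hWa, zero_div] at hfin
  have hq : 0 < ε + (b - a) := by linarith
  have : W b / (ε + (b - a)) ≤ (b - a) * K := by linarith
  rw [div_le_iff₀ hq] at this
  show W b ≤ _
  linarith

lemma step1 (h : Sol N m T u v vr ut) 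
    {a b R : ℝ} (ha : a ∈ Ico 0 T) (hab : a < b) (hb : b < T) (hR : 0 < R) :
    ∫ r in (0:ℝ)..R, (Ph N u r b - Ph N u r a) ^ 2 / (2 * Sw N r) ≤ (b - a) ^ 2 * Gr N v a := by
  obtain ⟨C, η, hC, hη, b1, b2, -⟩ := h.ph_bound
  have b1' : ∀ r, 0 ≤ r → ∀ t ∈ Ico 0 T, ∀ a ∈ Ico 0 T,
      (Ph N u r t - Ph N u r a) ^ 2 ≤ C * Sw N r := by
    intro r hr t ht a ha
    refine (b1 r hr t ht a ha).trans ?_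
    have : Real.exp (-η * r) ≤ 1 := Real.exp_le_one_iff.2 (by nlinarith)
    have := mul_le_mul_of_nonneg_left this hC.le
    have := mul_le_mul_of_nonneg_right this (Sw_nonneg N hr)
    linarith
  have hpc := h.ph_cont
  have hΨ : Continuous (fun p : ℝ × ℝ => Ph N u p.1 p.2 - Ph N u p.1 a) := by
    refine hpc.sub ?_
    exact hpc.comp (f := fun p : ℝ × ℝ => ((p.1, a) : ℝ × ℝ)) (by fun_prop)
  have hbI : b ∈ Ico 0 T := ⟨ha.1.trans hab.le, hb⟩
  have hε : ∀ ε > 0, ∫ r in (0:ℝ)..R, (Ph N u r b - Ph N u r a) ^ 2 / (2 * Sw N r) ≤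
      (ε + (b - a)) * ((b - a) * Gr N v a) := by
    intro ε hε
    have lim : Tendsto (fun R' => (ε + (b - a)) * ((b - a) * (Gr N v a + C * Real.exp (-η * R') / ε))) atTop
        (𝓝 ((ε + (b - a)) * ((b - a) * (Gr N v a + C * 0 / ε)))) := by
      have : Tendsto (fun R' => Real.exp (-η * R')) atTop (𝓝 0) :=
        Real.tendsto_exp_atBot.comp (tendsto_id.const_mul_atTop_of_neg (by linarith))
      exact (((((this.const_mul C).div_const ε).const_add _).const_mul _).const_mul _)
    simp only [mul_zero, zero_div, add_zero] at lim
    refine ge_of_tendsto lim ?_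
    filter_upwards [eventually_ge_atTop R] with R' hR'
    refine le_trans ?_ (h.step1_aux hC b1 b1' b2 ha hab hb (hR.trans_le hR') hε)
    exact W_mono (Ψ := fun r t => Ph N u r t - Ph N u r a) hΨ hR.le hR' (fun r hr => b1' r hr b hbI a ha)
  have lim : Tendsto (fun ε => (ε + (b - a)) * ((b - a) * Gr N v a)) (𝓝[>] 0)
      (𝓝 ((0 + (b - a)) * ((b - a) * Gr N v a))) := by
    have : Continuous (fun ε => (ε + (b - a)) * ((b - a) * Gr N v a)) := by fun_prop
    exact (this.tendsto 0).mono_left nhdsWithin_le_nhds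
  have := ge_of_tendsto lim (by filter_upwards [self_mem_nhdsWithin] with ε h; exact hε ε h)
  linarith

end Sol

namespace Sol
variable {N : ℕ} {m T : ℝ} {u v vr ut : ℝ → ℝ → ℝ}

/-- shifted increments -/
noncomputable def DD (N : ℕ) (u v : ℝ → ℝ → ℝ) (k t r : ℝ) : ℝ :=
  (u r (t + k) - u r t) * (v r (t + k) - v r t) * Sw N r

lemma DD_cont (h : Sol N m T u v vr ut) (k : ℝ) : Continuous (fun p : ℝ × ℝ => DD N u v k p.1 p.2) := by
  unfold DD
  have c1 : Continuous (fun p : ℝ × ℝ => u p.2 (p.1 + k)) :=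
    h.cu.comp (f := fun p : ℝ × ℝ => ((p.2, p.1 + k) : ℝ × ℝ)) (by fun_prop)
  have c2 : Continuous (fun p : ℝ × ℝ => u p.2 p.1) :=
    h.cu.comp (f := fun p : ℝ × ℝ => ((p.2, p.1) : ℝ × ℝ)) (by fun_prop)
  have c3 : Continuous (fun p : ℝ × ℝ => v p.2 (p.1 + k)) :=
    h.cv.comp (f := fun p : ℝ × ℝ => ((p.2, p.1 + k) : ℝ × ℝ)) (by fun_prop)
  have c4 : Continuous (fun p : ℝ × ℝ => v p.2 p.1) :=
    h.cv.comp (f := fun p : ℝ × ℝ => ((p.2, p.1) : ℝ × ℝ)) (by fun_prop)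
  exact ((c1.sub c2).mul (c3.sub c4)).mul ((Sw_cont N).comp continuous_snd)

lemma DD_nonneg (h : Sol N m T u v vr ut) (k t : ℝ) {r : ℝ} (hr : 0 ≤ r) : 0 ≤ DD N u v k t r :=
  mul_nonneg (h.mono_uv r (t + k) t) (Sw_nonneg N hr)

lemma DDi_cont (h : Sol N m T u v vr ut) (k R : ℝ) :
    Continuous (fun t => ∫ r in (0:ℝ)..R, DD N u v k t r) :=
  intervalIntegral.continuous_parametric_intervalIntegral_of_continuous' (h.DD_cont k) _ _

lemma step2_aux (h : Sol N m T u v vr ut) {C η : ℝ} 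
    (b1' : ∀ r, 0 ≤ r → ∀ t ∈ Ico 0 T, ∀ a ∈ Ico 0 T,
      (Ph N u r t - Ph N u r a) ^ 2 ≤ C * Sw N r)
    (b2 : ∀ r, 0 ≤ r → ∀ t ∈ Ico 0 T, ∀ a ∈ Ico 0 T, ∀ t' ∈ Ico 0 T, ∀ a' ∈ Ico 0 T,
      |Ph N u r t - Ph N u r a| * |v r t' - v r a'| ≤ C * Real.exp (-η * r))
    {a b R R' k : ℝ} (ha : a ∈ Ico 0 T) (hab : a < b) (hk : 0 < k) (hb : b + k < T) (hR : 0 < R) (hRR : R ≤ R') :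
    (∫ r in (0:ℝ)..R', (Ph N u r (b + k) - Ph N u r b) ^ 2 / (2 * Sw N r)) + 
      (∫ t in a..b, ∫ r in (0:ℝ)..R, DD N u v k t r) ≤
      (∫ r in (0:ℝ)..R', (Ph N u r (a + k) - Ph N u r a) ^ 2 / (2 * Sw N r)) +
      (b - a) * (C * Real.exp (-η * R')) := by
  have hR' : 0 < R' := hR.trans_le hRR
  set Ψ : ℝ → ℝ → ℝ := fun r t => Ph N u r (t + k) - Ph N u r t with hΨd
  have hpc := h.ph_cont
  have hΨ : Continuous (fun p : ℝ × ℝ => Ψ p.1 p.2) := by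
    refine Continuous.sub ?_ hpc
    exact hpc.comp (f := fun p : ℝ × ℝ => ((p.1, p.2 + k) : ℝ × ℝ)) (by fun_prop)
  have sub : ∀ x ∈ Icc a b, x ∈ Ico 0 T ∧ x + k ∈ Ico 0 T := fun x hx =>
    ⟨⟨ha.1.trans hx.1, by linarith [hx.2]⟩, by linarith [ha.1, hx.1], by linarith [hx.2]⟩
  have sub2 : ∀ x ∈ Ioo a b, x ∈ Ioo 0 T ∧ x + k ∈ Ioo 0 T := fun x hx =>
    ⟨⟨ha.1.trans_lt hx.1, by linarith [hx.2]⟩, by linarith [ha.1, hx.1], by linarith [hx.2]⟩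
  have hbd : ∀ r, 0 ≤ r → ∀ t ∈ Icc a b, Ψ r t ^ 2 ≤ C * Sw N r :=
    fun r hr t ht => b1' r hr _ (sub t ht).2 _ (sub t ht).1
  set W : ℝ → ℝ := fun t => ∫ r in (0:ℝ)..R', Ψ r t ^ 2 / (2 * Sw N r) with hW
  have hWc : ContinuousOn W (Icc a b) := genA_cont hΨ hR'.le hbd
  have hWd : ∀ t ∈ Ioo a b, HasDerivAt W (∫ r in (0:ℝ)..R', Ψ r t * (vr r (t + k) - vr r t)) t := by
    intro t ht
    refine genA_deriv (z := fun r t => vr r (t + k) - vr r t) hΨ hR'.le hbd ?_ ?_ ht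
    · refine ContinuousOn.sub ?_ (h.cvr.mono (prod_mono_right (fun x hx => (sub2 x hx).1)))
      exact h.cvr.comp (f := fun p : ℝ × ℝ => ((p.1, p.2 + k) : ℝ × ℝ)) (by fun_prop)
        (fun p hp => ⟨hp.1, (sub2 _ hp.2).2⟩)
    · intro r hr s hs
      have h1 := (h.ph_dt hr.le (sub2 s hs).2).comp_add_const s k
      refine (h1.sub (h.ph_dt hr.le (sub2 s hs).1)).congr_deriv ?_
      ring
  set Dc : ℝ → ℝ := fun t => ∫ r in (0:ℝ)..R, DD N u v k t r with hDc
  have hDcc : Continuous Dc := h.DDi_cont k R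
  set E := C * Real.exp (-η * R') with hE
  have hanti : AntitoneOn (fun t => W t + (∫ s in a..t, Dc s) - t * E) (Icc a b) := by
    have hd : ∀ t ∈ Ioo a b, HasDerivAt (fun t => W t + (∫ s in a..t, Dc s) - t * E)
        ((∫ r in (0:ℝ)..R', Ψ r t * (vr r (t + k) - vr r t)) + Dc t - 1 * E) t := by
      intro t ht
      have h2 : HasDerivAt (fun t => ∫ s in a..t, Dc s) (Dc t) t :=
        intervalIntegral.integral_hasDerivAt_right (hDcc.intervalIntegrable _ _)
          (hDcc.stronglyMeasurableAtFilter _ _) hDcc.continuousAt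
      exact ((hWd t ht).add h2).sub ((hasDerivAt_id t).mul_const E)
    apply antitoneOn_of_deriv_nonpos (convex_Icc a b)
    · have : Continuous (fun t => ∫ s in a..t, Dc s) :=
        intervalIntegral.continuous_primitive (fun _ _ => hDcc.intervalIntegrable _ _) _
      exact (hWc.add this.continuousOn).sub (by fun_prop)
    · rw [interior_Icc]
      exact fun t ht => (hd t ht).differentiableAt.differentiableWithinAt
    · rw [interior_Icc]
      intro t ht
      rw [(hd t ht).deriv]
      obtain ⟨s1, s2⟩ := sub2 t ht
      have s1' := Ioo_subset_Ico_self s1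
      have s2' := Ioo_subset_Ico_self s2
      have hPd : ∀ r, HasDerivAt (fun r => Ψ r t) ((u r (t + k) - u r t) * Sw N r) r := by
        intro r
        refine ((h.ph_dr r (t + k)).sub (h.ph_dr r t)).congr_deriv ?_
        ring
      have hP0 : Ψ 0 t = 0 := by simp [hΨd, Ph]
      have hPc : Continuous (fun r => Ψ r t) := continuous_iff_continuousAt.2 fun r => (hPd r).continuousAt
      have cuu : Continuous (fun r => u r (t + k) - u r t) := (h.cu_r _).sub (h.cu_r _)
      have cvv : Continuous (fun r => v r (t + k) - v r t) := (h.cv_r _).sub (h.cv_r _)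
      have I1 : ∫ r in (0:ℝ)..R', Ψ r t * (vr r (t + k) - vr r t) =
          Ψ R' t * (v R' (t + k) - v R' t) - ∫ r in (0:ℝ)..R', DD N u v k t r := by
        have := intervalIntegral.integral_mul_deriv_eq_deriv_mul_of_hasDerivAt (a := 0) (b := R')
          (u := fun r => Ψ r t) (v := fun r => v r (t + k) - v r t) (u' := fun r => (u r (t + k) - u r t) * Sw N r)
          (v' := fun r => vr r (t + k) - vr r t) hPc.continuousOn cvv.continuousOn
          (fun x _ => hPd x)
          (fun x hx => by
            rw [min_eq_left hR'.le] at hx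
            exact (h.dv x hx.1 _ s2).sub (h.dv x hx.1 _ s1))
          ((cuu.mul (Sw_cont N)).intervalIntegrable _ _)
          ((((h.cvr_r s2).sub (h.cvr_r s1)).mono Icc_subset_Ici_self).intervalIntegrable_of_Icc hR'.le)
        rw [this, hP0, zero_mul, sub_zero]
        congr 2
        funext x
        unfold DD; ring
      have cD : Continuous (fun r => DD N u v k t r) :=
        (h.DD_cont k).comp (f := fun r : ℝ => ((t, r) : ℝ × ℝ)) (by fun_prop)
      have I2 : Dc t ≤ ∫ r in (0:ℝ)..R', DD N u v k t r := by
        rw [hDc, ← intervalIntegral.integral_add_adjacent_intervals (b := R) (c := R')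
          (cD.intervalIntegrable _ _) (cD.intervalIntegrable _ _)]
        have : 0 ≤ ∫ r in R..R', DD N u v k t r :=
          intervalIntegral.integral_nonneg hRR (fun x hx => h.DD_nonneg _ _ (hR.le.trans hx.1))
        simp only; linarith
      have I4 : Ψ R' t * (v R' (t + k) - v R' t) ≤ E := by
        have := b2 R' hR'.le _ s2' _ s1' _ s2' _ s1'
        rw [← abs_mul] at this
        exact (le_abs_self _).trans this
      rw [I1]; linarith
  have hfin := hanti (left_mem_Icc.2 hab.le) (right_mem_Icc.2 hab.le) hab.le
  simp only [intervalIntegral.integral_same] at hfin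
  show W b + (∫ t in a..b, Dc t) ≤ W a + (b - a) * E
  linarith

lemma step2 (h : Sol N m T u v vr ut) 
    {a a' b R k : ℝ} (ha : a ∈ Ico 0 T) (haa : a ≤ a') (hab : a' < b) (hk : 0 < k) (hb : b + k < T) (hR : 0 < R) :
    (∫ r in (0:ℝ)..R, (Ph N u r (b + k) - Ph N u r b) ^ 2 / (2 * Sw N r)) + 
      (∫ t in a'..b, ∫ r in (0:ℝ)..R, DD N u v k t r) ≤ k ^ 2 * Gr N v a := by
  obtain ⟨C, η, hC, hη, b1, b2, -⟩ := h.ph_bound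
  have b1' : ∀ r, 0 ≤ r → ∀ t ∈ Ico 0 T, ∀ a ∈ Ico 0 T,
      (Ph N u r t - Ph N u r a) ^ 2 ≤ C * Sw N r := by
    intro r hr t ht a ha
    refine (b1 r hr t ht a ha).trans ?_
    have : Real.exp (-η * r) ≤ 1 := Real.exp_le_one_iff.2 (by nlinarith)
    have := mul_le_mul_of_nonneg_left this hC.le
    have := mul_le_mul_of_nonneg_right this (Sw_nonneg N hr)
    linarith
  have hpc := h.ph_cont
  have hΨ : Continuous (fun p : ℝ × ℝ => Ph N u p.1 (p.2 + k) - Ph N u p.1 p.2) := by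
    refine Continuous.sub ?_ hpc
    exact hpc.comp (f := fun p : ℝ × ℝ => ((p.1, p.2 + k) : ℝ × ℝ)) (by fun_prop)
  have h1 : b ∈ Ico 0 T := ⟨by linarith [ha.1], by linarith⟩
  have h2 : b + k ∈ Ico 0 T := ⟨by linarith [ha.1], by linarith⟩
  have lim : Tendsto (fun R' => k ^ 2 * Gr N v a + (b - a) * (C * Real.exp (-η * R'))) atTop
        (𝓝 (k ^ 2 * Gr N v a + (b - a) * (C * 0))) := by
    have : Tendsto (fun R' => Real.exp (-η * R')) atTop (𝓝 0) :=
        Real.tendsto_exp_atBot.comp (tendsto_id.const_mul_atTop_of_neg (by linarith))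
    exact (((this.const_mul C).const_mul _).const_add _)
  simp only [mul_zero, add_zero] at lim
  refine ge_of_tendsto lim ?_
  filter_upwards [eventually_ge_atTop R] with R' hR'
  have A1 := h.step2_aux b1' b2 (b := b) (R := R) (R' := R') ha (by linarith) hk hb hR hR'
  have A2 := h.step1 (b := a + k) (R := R') ha (by linarith) (by linarith) (by linarith)
  have A3 := W_mono (N := N) (t := b) (Ψ := fun r t => Ph N u r (t + k) - Ph N u r t) hΨ hR.le hR'
    (fun r hr => b1' r hr _ h2 _ h1)
  have A4 : (∫ t in a'..b, ∫ r in (0:ℝ)..R, DD N u v k t r) ≤ ∫ t in a..b, ∫ r in (0:ℝ)..R, DD N u v k t r := by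
    have c := h.DDi_cont k R
    rw [← intervalIntegral.integral_add_adjacent_intervals (b := a') (c := b)
          (c.intervalIntegrable a _) (c.intervalIntegrable _ _)]
    have : 0 ≤ ∫ t in a..a', ∫ r in (0:ℝ)..R, DD N u v k t r :=
      intervalIntegral.integral_nonneg haa fun t _ => 
        intervalIntegral.integral_nonneg hR.le (fun x hx => h.DD_nonneg _ _ hx.1)
    linarith
  have e : a + k - a = k := by ring
  rw [e] at A2
  linarith

lemma mvt_bound {f f' : ℝ → ℝ} {t k B : ℝ} (hk : 0 < k)
    (hf : ∀ s ∈ Icc t (t + k), HasDerivAt f (f' s) s) (hB : ∀ s ∈ Icc t (t + k), |f' s| ≤ B) :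
    |f (t + k) - f t| ≤ B * k := by
  have hc : ContinuousOn f (Icc t (t + k)) := fun s hs => (hf s hs).continuousAt.continuousWithinAt
  obtain ⟨c, hc1, hc2⟩ := exists_hasDerivAt_eq_slope f f' (by linarith : t < t + k) hc
    (fun x hx => hf x (Ioo_subset_Icc_self hx))
  have h3 := hB c (Ioo_subset_Icc_self hc1)
  rw [hc2, abs_div, div_le_iff₀ (by simpa using hk.ne')] at h3
  have : |t + k - t| = k := by rw [add_sub_cancel_left, abs_of_pos hk]
  rwa [this] at h3

lemma slope_tendsto {f : ℝ → ℝ} {f' t : ℝ} (hf : HasDerivAt f f' t) :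
    Tendsto (fun k => (f (t + k) - f t) / k) (𝓝[>] 0) (𝓝 f') := by
  have := (hasDerivAt_iff_tendsto_slope_zero.1 hf).mono_left
    (nhdsWithin_mono 0 (fun x (hx : x ∈ Ioi 0) => (ne_of_gt hx : x ≠ 0)))
  refine this.congr fun k => ?_
  rw [smul_eq_mul]; field_simp

end Sol

namespace Sol
variable {N : ℕ} {m T : ℝ} {u v vr ut : ℝ → ℝ → ℝ}

/-- dissipation density -/
noncomputable def dd (N : ℕ) (m : ℝ) (u ut : ℝ → ℝ → ℝ) (t r : ℝ) : ℝ :=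
  m * u r t ^ (m - 1) * ut r t ^ 2 * Sw N r

lemma dd_nonneg (h : Sol N m T u v vr ut) (t : ℝ) {r : ℝ} (hr : 0 ≤ r) : 0 ≤ dd N m u ut t r := by
  have := h.m0; have := h.un r t; have := Sw_nonneg N hr
  unfold dd; positivity

lemma vt_cont (h : Sol N m T u v vr ut) :
    ContinuousOn (fun p : ℝ × ℝ => m * u p.1 p.2 ^ (m - 1) * ut p.1 p.2) (Ici 0 ×ˢ Ioo 0 T) := by
  refine ContinuousOn.mul (continuousOn_const.mul ?_) h.cut
  exact h.cu.continuousOn.rpow_const (fun p hp => Or.inl (h.pos _ hp.1 _ hp.2).ne')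

lemma dd_cont (h : Sol N m T u v vr ut) :
    ContinuousOn (fun p : ℝ × ℝ => dd N m u ut p.2 p.1) (Ici 0 ×ˢ Ioo 0 T) := by
  unfold dd
  refine ContinuousOn.mul (ContinuousOn.mul (continuousOn_const.mul ?_) (h.cut.pow 2)) 
    ((Sw_cont N).comp continuous_fst).continuousOn
  exact h.cu.continuousOn.rpow_const (fun p hp => Or.inl (h.pos _ hp.1 _ hp.2).ne')

lemma step3 (h : Sol N m T u v vr ut) 
    {a a' b R : ℝ} (ha : a ∈ Ico 0 T) (haa : a < a') (hab : a' < b) (hb : b < T) (hR : 0 < R) :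
    (∫ r in (0:ℝ)..R, 1 / 2 * vr r b ^ 2 * Sw N r) + 
      (∫ t in a'..b, ∫ r in (0:ℝ)..R, dd N m u ut t r) ≤ Gr N v a := by
  obtain ⟨b', hbb', hb'T⟩ := exists_between hb
  have ha0 := ha.1
  have hK : Icc 0 R ×ˢ Icc a' b' ⊆ Ici 0 ×ˢ Ioo 0 T := by
    rintro ⟨x, y⟩ ⟨hx, hy⟩
    exact ⟨hx.1, by linarith [hy.1], by linarith [hy.2]⟩
  have hKc : IsCompact (Icc 0 R ×ˢ Icc a' b') := isCompact_Icc.prod isCompact_Icc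
  obtain ⟨B1, hB1⟩ := hKc.exists_bound_of_continuousOn (h.cut.mono hK)
  obtain ⟨B2, hB2⟩ := hKc.exists_bound_of_continuousOn (h.vt_cont.mono hK)
  obtain ⟨B3, hB3⟩ := hKc.exists_bound_of_continuousOn (h.cvr.mono hK)
  obtain ⟨B4, hB4⟩ := isCompact_Icc.exists_bound_of_continuousOn (s := Icc 0 R) (Sw_cont N).continuousOn
  have hB1' : ∀ x ∈ Icc 0 R, ∀ s ∈ Icc a' b', |ut x s| ≤ B1 := fun x hx s hs => hB1 (x, s) ⟨hx, hs⟩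
  have hB2' : ∀ x ∈ Icc 0 R, ∀ s ∈ Icc a' b', |m * u x s ^ (m - 1) * ut x s| ≤ B2 := fun x hx s hs => hB2 (x, s) ⟨hx, hs⟩
  have hB3' : ∀ x ∈ Icc 0 R, ∀ s ∈ Icc a' b', |vr x s| ≤ B3 := fun x hx s hs => hB3 (x, s) ⟨hx, hs⟩
  have hB4' : ∀ x ∈ Icc 0 R, Sw N x ≤ B4 := fun x hx => (le_abs_self _).trans (hB4 x hx)
  have p0 : (0:ℝ) ∈ Icc 0 R := ⟨le_rfl, hR.le⟩
  have p1 : b ∈ Icc a' b' := ⟨hab.le, hbb'.le⟩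
  have B10 : 0 ≤ B1 := (abs_nonneg _).trans (hB1' 0 p0 b p1)
  have B20 : 0 ≤ B2 := (abs_nonneg _).trans (hB2' 0 p0 b p1)
  have B30 : 0 ≤ B3 := (abs_nonneg _).trans (hB3' 0 p0 b p1)
  have B40 : 0 ≤ B4 := (Sw_nonneg N le_rfl).trans (hB4' 0 p0)
  have hev : ∀ᶠ k in 𝓝[>] (0:ℝ), k ∈ Ioo 0 (b' - b) := Ioo_mem_nhdsGT (by linarith)
  have mem0 : ∀ s ∈ Icc a' b', s ∈ Ioo 0 T := fun s hs => ⟨by linarith [hs.1], by linarith [hs.2]⟩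
  -- first term
  have L1 : Tendsto (fun k => ∫ r in (0:ℝ)..R, (Ph N u r (b + k) - Ph N u r b) ^ 2 / (2 * Sw N r) / k ^ 2)
      (𝓝[>] 0) (𝓝 (∫ r in (0:ℝ)..R, 1 / 2 * vr r b ^ 2 * Sw N r)) := by
    apply intervalIntegral.tendsto_integral_filter_of_dominated_convergence (fun _ => B3 ^ 2 * B4 / 2)
    · refine Eventually.of_forall fun k => ?_
      have c : ∀ t, Continuous (fun r => Ph N u r t) := fun t =>
        h.ph_cont.comp (f := fun r : ℝ => ((r, t) : ℝ × ℝ)) (by fun_prop)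
      exact (((((c (b + k)).sub (c b)).pow 2).measurable.div
        ((Sw_cont N).measurable.const_mul 2)).div_const _).aestronglyMeasurable
    · filter_upwards [hev] with k hk
      refine Eventually.of_forall fun x hx => ?_
      rw [uIoc_of_le hR.le] at hx
      have hxI := Ioc_subset_Icc_self hx
      have hS := Sw_pos N hx.1
      have hk0 := hk.1
      have sb : ∀ s ∈ Icc b (b + k), s ∈ Icc a' b' := fun s hs => ⟨by linarith [hs.1], by linarith [hs.2, hk.2]⟩
      have := mvt_bound (f := fun t => Ph N u x t) (f' := fun t => Sw N x * vr x t) (t := b) (B := Sw N x * B3) hk0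
        (fun s hs => h.ph_dt hx.1.le (mem0 s (sb s hs))) (fun s hs => by
          rw [abs_mul, abs_of_pos hS]
          exact mul_le_mul_of_nonneg_left (hB3' x hxI s (sb s hs)) hS.le)
      rw [Real.norm_of_nonneg (by positivity), div_div, div_le_iff₀ (by positivity), ← sq_abs]
      calc |Ph N u x (b + k) - Ph N u x b| ^ 2 ≤ (Sw N x * B3 * k) ^ 2 := pow_le_pow_left₀ (abs_nonneg _) this 2
        _ = (B3 ^ 2 * k ^ 2 * Sw N x) * Sw N x := by ring
        _ ≤ (B3 ^ 2 * k ^ 2 * Sw N x) * B4 := mul_le_mul_of_nonneg_left (hB4' x hxI) (by positivity)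
        _ = _ := by ring
    · exact intervalIntegrable_const
    · refine Eventually.of_forall fun x hx => ?_
      rw [uIoc_of_le hR.le] at hx
      have hS := Sw_pos N hx.1
      have := slope_tendsto (h.ph_dt hx.1.le (mem0 b p1))
      have h2 := (this.pow 2).div_const (2 * Sw N x)
      have e : (Sw N x * vr x b) ^ 2 / (2 * Sw N x) = 1 / 2 * vr x b ^ 2 * Sw N x := by field_simp
      rw [e] at h2
      refine h2.congr fun k => ?_
      rw [div_pow, div_right_comm]
  have L2 : Tendsto (fun k => ∫ t in a'..b, ∫ r in (0:ℝ)..R, DD N u v k t r / k ^ 2)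
      (𝓝[>] 0) (𝓝 (∫ t in a'..b, ∫ r in (0:ℝ)..R, dd N m u ut t r)) := by
    have bd : ∀ k ∈ Ioo 0 (b' - b), ∀ t ∈ Icc a' b, ∀ x ∈ Ioc 0 R, ‖DD N u v k t x / k ^ 2‖ ≤ B1 * B2 * B4 := by
      intro k hk t ht x hx
      have hxI := Ioc_subset_Icc_self hx
      have hS := Sw_pos N hx.1
      have hk0 := hk.1
      have sb : ∀ s ∈ Icc t (t + k), s ∈ Icc a' b' := fun s hs => ⟨by linarith [hs.1, ht.1], by linarith [hs.2, hk.2, ht.2]⟩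
      have m1 := mvt_bound (f := fun t => u x t) (f' := fun t => ut x t) (t := t) (B := B1) hk0
        (fun s hs => h.du x hx.1.le s (mem0 s (sb s hs))) (fun s hs => hB1' x hxI s (sb s hs))
      have m2 := mvt_bound (f := fun t => v x t) (f' := fun t => m * u x t ^ (m - 1) * ut x t) (t := t) (B := B2) hk0
        (fun s hs => h.dvt hx.1.le (mem0 s (sb s hs))) (fun s hs => hB2' x hxI s (sb s hs))
      rw [norm_div, Real.norm_of_nonneg (by positivity : 0 ≤ k ^ 2), div_le_iff₀ (by positivity)]
      unfold DD
      rw [norm_mul, norm_mul, Real.norm_eq_abs, Real.norm_eq_abs, Real.norm_of_nonneg hS.le]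
      calc _ ≤ (B1 * k) * (B2 * k) * B4 := by
            apply mul_le_mul (mul_le_mul m1 m2 (abs_nonneg _) (by positivity)) (hB4' x hxI) hS.le (by positivity)
        _ = _ := by ring
    apply intervalIntegral.tendsto_integral_filter_of_dominated_convergence (fun _ => B1 * B2 * B4 * |R - 0|)
    · refine Eventually.of_forall fun k => ?_
      have : Continuous (fun t => ∫ r in (0:ℝ)..R, DD N u v k t r / k ^ 2) := by
        simp_rw [intervalIntegral.integral_div]
        exact (h.DDi_cont k R).div_const _
      exact this.aestronglyMeasurable
    · filter_upwards [hev] with k hk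
      refine Eventually.of_forall fun t ht => ?_
      rw [uIoc_of_le hab.le] at ht
      refine intervalIntegral.norm_integral_le_of_norm_le_const fun x hx => ?_
      rw [uIoc_of_le hR.le] at hx
      exact bd k hk t (Ioc_subset_Icc_self ht) x hx
    · exact intervalIntegrable_const
    · refine Eventually.of_forall fun t ht => ?_
      rw [uIoc_of_le hab.le] at ht
      have htI : t ∈ Icc a' b' := ⟨ht.1.le, by linarith [ht.2]⟩
      apply intervalIntegral.tendsto_integral_filter_of_dominated_convergence (fun _ => B1 * B2 * B4)
      · refine Eventually.of_forall fun k => ?_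
        have cD : Continuous (fun r => DD N u v k t r) :=
          (h.DD_cont k).comp (f := fun r : ℝ => ((t, r) : ℝ × ℝ)) (by fun_prop)
        exact (cD.div_const _).aestronglyMeasurable
      · filter_upwards [hev] with k hk
        refine Eventually.of_forall fun x hx => ?_
        rw [uIoc_of_le hR.le] at hx
        exact bd k hk t (Ioc_subset_Icc_self ht) x hx
      · exact intervalIntegrable_const
      · refine Eventually.of_forall fun x hx => ?_
        rw [uIoc_of_le hR.le] at hx
        have q1 := slope_tendsto (h.du x hx.1.le t (mem0 t htI))
        have q2 := slope_tendsto (h.dvt hx.1.le (mem0 t htI))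
        have q3 := (q1.mul q2).mul_const (Sw N x)
        have e : ut x t * (m * u x t ^ (m - 1) * ut x t) * Sw N x = dd N m u ut t x := by unfold dd; ring
        rw [e] at q3
        refine q3.congr fun k => ?_
        unfold DD
        rw [div_mul_div_comm, ← sq, div_mul_eq_mul_div]
  refine le_of_tendsto (L1.add L2) ?_
  filter_upwards [hev] with k hk
  have hk0 := hk.1
  have := h.step2 (R := R) ha haa.le hab hk0 (by linarith [hk.2]) hR
  simp_rw [intervalIntegral.integral_div]
  rw [← add_div, div_le_iff₀ (by positivity)]
  linarith

end Sol

lemma setL_tendsto {f : ℝ → ENNReal} {s : ℕ → Set ℝ} (hs : Monotone s) :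
    Tendsto (fun n => ∫⁻ x in s n, f x) atTop (𝓝 (∫⁻ x in ⋃ n, s n, f x)) := by
  rw [setLIntegral_iUnion_of_directed f (directed_of_isDirected_le hs)]
  exact tendsto_atTop_iSup fun i j hij => lintegral_mono_set (hs hij)

lemma iUnion_Ioc_nat : (⋃ n : ℕ, Ioc (0:ℝ) (n + 1)) = Ioi 0 := by
  ext x
  simp only [mem_iUnion, mem_Ioc, mem_Ioi]
  constructor
  · rintro ⟨n, h, -⟩; exact h
  · intro h
    obtain ⟨n, hn⟩ := exists_nat_ge x
    exact ⟨n, h, by linarith⟩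

lemma iUnion_Ioc_left {a b : ℝ} : (⋃ n : ℕ, Ioc (a + 1 / ((n:ℝ) + 1)) b) = Ioc a b := by
  ext x
  simp only [mem_iUnion, mem_Ioc]
  constructor
  · rintro ⟨n, h, h2⟩
    have : 0 < 1 / ((n:ℝ) + 1) := by positivity
    exact ⟨by linarith, h2⟩
  · rintro ⟨h, h2⟩
    obtain ⟨n, hn⟩ := exists_nat_one_div_lt (sub_pos.2 h)
    exact ⟨n, by linarith, h2⟩

namespace Sol
variable {N : ℕ} {m T : ℝ} {u v vr ut : ℝ → ℝ → ℝ}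

lemma dd_meas (h : Sol N m T u v vr ut) : Measurable (fun p : ℝ × ℝ => dd N m u ut p.1 p.2) := by
  unfold dd
  have m1 : Measurable (fun p : ℝ × ℝ => u p.2 p.1) := h.cu.measurable.comp measurable_swap
  have m2 : Measurable (fun p : ℝ × ℝ => ut p.2 p.1) := h.mesut.comp measurable_swap
  have m3 : Measurable (fun p : ℝ × ℝ => Sw N p.2) := (Sw_cont N).measurable.comp measurable_snd
  exact (((m1.pow_const _).const_mul m).mul (m2.pow_const 2)).mul m3

/-- dissipation -/
noncomputable def De (N : ℕ) (m : ℝ) (u ut : ℝ → ℝ → ℝ) (t : ℝ) : ENNReal :=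
  ∫⁻ r in Ioi (0:ℝ), ENNReal.ofReal (dd N m u ut t r)

lemma De_meas (h : Sol N m T u v vr ut) : Measurable (De N m u ut) :=
  (h.dd_meas.ennreal_ofReal).lintegral_prod_right' (ν := volume.restrict (Ioi 0))

lemma dd_int (h : Sol N m T u v vr ut) {t R : ℝ} (ht : t ∈ Ioo 0 T) :
    IntegrableOn (fun r => dd N m u ut t r) (Ioc 0 R) := by
  have : ContinuousOn (fun r => dd N m u ut t r) (Icc 0 R) :=
    h.dd_cont.comp (f := fun r : ℝ => ((r, t) : ℝ × ℝ)) (by fun_prop) (fun r hr => ⟨hr.1, ht⟩)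
  exact (this.integrableOn_compact isCompact_Icc).mono_set Ioc_subset_Icc_self

lemma gr_eq (h : Sol N m T u v vr ut) {b : ℝ} (hb : b ∈ Ioo 0 T) :
    IntegrableOn (fun r => 1 / 2 * vr r b ^ 2 * Sw N r) (Ioi 0) ∧
    ∫ r in Ioi (0:ℝ), 1 / 2 * vr r b ^ 2 * Sw N r = Gr N v b := by
  have e : EqOn (fun r => 1 / 2 * deriv (fun ρ => v ρ b) r ^ 2 * Sw N r)
      (fun r => 1 / 2 * vr r b ^ 2 * Sw N r) (Ioi 0) := by
    intro r hr
    simp only [(h.dv r hr b hb).deriv]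
  refine ⟨(h.gr_int (Ioo_subset_Ico_self hb)).congr_fun e measurableSet_Ioi, ?_⟩
  exact (setIntegral_congr_fun measurableSet_Ioi e).symm

lemma step4_fin (h : Sol N m T u v vr ut) 
    {a a' b R : ℝ} (ha : a ∈ Ico 0 T) (haa : a < a') (hab : a' < b) (hb : b < T) (hR : 0 < R) :
    ENNReal.ofReal (∫ r in (0:ℝ)..R, 1 / 2 * vr r b ^ 2 * Sw N r) + 
      (∫⁻ t in Ioc a' b, ∫⁻ r in Ioc 0 R, ENNReal.ofReal (dd N m u ut t r)) ≤ ENNReal.ofReal (Gr N v a) := by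
  have key := h.step3 ha haa hab hb hR
  have ha0 := ha.1
  have mem0 : ∀ s ∈ Icc a' b, s ∈ Ioo 0 T := fun s hs => ⟨by linarith [hs.1], by linarith [hs.2]⟩
  have hm : StronglyMeasurable (fun t => ∫ r in Ioc 0 R, dd N m u ut t r) :=
    (h.dd_meas.stronglyMeasurable).integral_prod_right' (ν := volume.restrict (Ioc 0 R))
  obtain ⟨B, hB⟩ := (isCompact_Icc.prod isCompact_Icc : IsCompact (Icc 0 R ×ˢ Icc a' b)).exists_bound_of_continuousOn 
    (h.dd_cont.mono (fun p hp => ⟨hp.1.1, mem0 _ hp.2⟩))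
  have hnn : ∀ t, 0 ≤ ∫ r in Ioc 0 R, dd N m u ut t r := fun t =>
    setIntegral_nonneg measurableSet_Ioc fun x hx => h.dd_nonneg t hx.1.le
  have hint : IntegrableOn (fun t => ∫ r in Ioc 0 R, dd N m u ut t r) (Ioc a' b) := by
    refine Measure.integrableOn_of_bounded (M := B * R) (by simp) hm.aestronglyMeasurable ?_
    filter_upwards [ae_restrict_mem measurableSet_Ioc] with t ht
    have := norm_setIntegral_le_of_norm_le_const (μ := volume) (s := Ioc 0 R) (C := B) (f := fun r => dd N m u ut t r) (by simp)
      (fun x hx => hB (x, t) ⟨Ioc_subset_Icc_self hx, Ioc_subset_Icc_self ht⟩)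
    simpa [hR.le] using this
  have e1 : (∫⁻ t in Ioc a' b, ∫⁻ r in Ioc 0 R, ENNReal.ofReal (dd N m u ut t r)) =
      ∫⁻ t in Ioc a' b, ENNReal.ofReal (∫ r in Ioc 0 R, dd N m u ut t r) := by
    apply setLIntegral_congr_fun measurableSet_Ioc
    intro t ht
    simp only
    rw [ofReal_integral_eq_lintegral_ofReal (h.dd_int (mem0 t (Ioc_subset_Icc_self ht)))]
    filter_upwards [ae_restrict_mem measurableSet_Ioc] with x hx
    exact h.dd_nonneg t hx.1.le
  rw [e1, ← ofReal_integral_eq_lintegral_ofReal hint (Eventually.of_forall hnn), ← ENNReal.ofReal_add]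
  · apply ENNReal.ofReal_le_ofReal
    simp_rw [intervalIntegral.integral_of_le hR.le] at key ⊢
    rw [intervalIntegral.integral_of_le hab.le] at key
    exact key
  · apply intervalIntegral.integral_nonneg hR.le
    intro x hx
    have := Sw_nonneg N hx.1
    positivity
  · exact setIntegral_nonneg measurableSet_Ioc fun x _ => hnn x

lemma step4 (h : Sol N m T u v vr ut) 
    {a b : ℝ} (ha : a ∈ Ico 0 T) (hab : a < b) (hb : b < T) :
    ENNReal.ofReal (Gr N v b) + ∫⁻ t in Ioc a b, De N m u ut t ≤ ENNReal.ofReal (Gr N v a) := by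
  have hbI : b ∈ Ioo 0 T := ⟨ha.1.trans_lt hab, hb⟩
  have A : ∀ a', a < a' → a' < b →
      ENNReal.ofReal (Gr N v b) + ∫⁻ t in Ioc a' b, De N m u ut t ≤ ENNReal.ofReal (Gr N v a) := by
    intro a' haa hab
    have t1 : Tendsto (fun n : ℕ => ENNReal.ofReal (∫ r in (0:ℝ)..(n + 1), 1 / 2 * vr r b ^ 2 * Sw N r)) atTop
        (𝓝 (ENNReal.ofReal (Gr N v b))) := by
      obtain ⟨g1, g2⟩ := h.gr_eq hbI
      rw [← g2]
      refine ENNReal.tendsto_ofReal (intervalIntegral_tendsto_integral_Ioi 0 g1 ?_)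
      exact tendsto_atTop_add_const_right _ _ tendsto_natCast_atTop_atTop
    have mono : Monotone (fun n : ℕ => Ioc (0:ℝ) (n + 1)) := fun i j hij =>
      Ioc_subset_Ioc_right (by have : (i:ℝ) ≤ j := by exact_mod_cast hij
                               linarith)
    have t2 : Tendsto (fun n : ℕ => ∫⁻ t in Ioc a' b, ∫⁻ r in Ioc (0:ℝ) (n + 1), ENNReal.ofReal (dd N m u ut t r)) atTop
        (𝓝 (∫⁻ t in Ioc a' b, De N m u ut t)) := by
      apply lintegral_tendsto_of_tendsto_of_monotone
      · intro n
        exact ((h.dd_meas.ennreal_ofReal).lintegral_prod_right' (ν := volume.restrict (Ioc 0 ((n:ℝ) + 1)))).aemeasurable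
      · exact Eventually.of_forall fun t i j hij => lintegral_mono_set (mono hij)
      · refine Eventually.of_forall fun t => ?_
        have := setL_tendsto (f := fun r => ENNReal.ofReal (dd N m u ut t r)) mono
        rwa [iUnion_Ioc_nat] at this
    refine le_of_tendsto (t1.add t2) (Eventually.of_forall fun n => ?_)
    exact h.step4_fin ha haa hab hb (by positivity)
  have mono : Monotone (fun n : ℕ => Ioc (a + 1 / ((n:ℝ) + 1)) b) := fun i j hij =>
      Ioc_subset_Ioc_left (by
        have : (i:ℝ) ≤ j := by exact_mod_cast hij
        gcongr)
  have t3 := setL_tendsto (f := De N m u ut) mono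
  rw [iUnion_Ioc_left] at t3
  refine le_of_tendsto (t3.const_add _) ?_
  obtain ⟨n0, hn0⟩ := exists_nat_one_div_lt (sub_pos.2 hab)
  filter_upwards [eventually_ge_atTop n0] with n hn
  have : 1 / ((n:ℝ) + 1) ≤ 1 / ((n0:ℝ) + 1) := by
    have : (n0:ℝ) ≤ n := by exact_mod_cast hn
    gcongr
  have h2 : 0 < 1 / ((n:ℝ) + 1) := by positivity
  exact A _ (by linarith) (by linarith)

lemma gr_anti (h : Sol N m T u v vr ut) : AntitoneOn (Gr N v) (Ico 0 T) := by
  intro a ha b hb hab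
  rcases hab.eq_or_lt with rfl | hab
  · exact le_rfl
  · have := h.step4 ha hab hb.2
    have h2 := le_self_add.trans this
    exact (ENNReal.ofReal_le_ofReal_iff (gr_nonneg v a)).1 h2

end Sol

lemma tonelli_weight {b : ℝ} (hb : 0 < b) {G l l' : ℝ → ℝ} {D : ℝ → ENNReal} (hD : Measurable D)
    (hG0 : ∀ t, 0 ≤ G t) (hG : AntitoneOn G (Icc 0 b))
    (hl : ∀ t ∈ Icc 0 b, HasDerivAt l (l' t) t) (hl0 : l 0 = 1) (hlc : ContinuousOn l' (Icc 0 b))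
    (hl' : ∀ t ∈ Icc 0 b, 0 ≤ l' t)
    (key : ∀ a ∈ Ico 0 b, ENNReal.ofReal (G b) + ∫⁻ t in Ioc a b, D t ≤ ENNReal.ofReal (G a)) :
    IntegrableOn (fun t => (D t).toReal) (Ioc 0 b) ∧ (∀ᵐ t ∂volume.restrict (Ioc 0 b), D t < ⊤) ∧
    IntegrableOn (fun t => l' t * G t) (Ioc 0 b) ∧
    l b * G b + ∫ t in Ioc 0 b, l t * (D t).toReal ≤ G 0 + ∫ t in Ioc 0 b, l' t * G t := by
  have hlcont : ContinuousOn l (Icc 0 b) := fun t ht => (hl t ht).continuousAt.continuousWithinAt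
  have hfin : ∫⁻ t in Ioc 0 b, D t ≠ ⊤ := by
    have := key 0 ⟨le_rfl, hb⟩
    exact ne_top_of_le_ne_top ENNReal.ofReal_ne_top (le_add_self.trans this)
  have hDi : IntegrableOn (fun t => (D t).toReal) (Ioc 0 b) :=
    integrable_toReal_of_lintegral_ne_top hD.aemeasurable hfin
  have hae : ∀ᵐ t ∂volume.restrict (Ioc 0 b), D t < ⊤ := ae_lt_top hD hfin
  have hGi : IntegrableOn G (Ioc 0 b) :=
    (hG.integrableOn_isCompact isCompact_Icc).mono_set Ioc_subset_Icc_self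
  have hlGi : IntegrableOn (fun t => l' t * G t) (Ioc 0 b) := by
    have := (hG.integrableOn_isCompact (μ := volume) isCompact_Icc).continuousOn_mul hlc isCompact_Icc
    exact this.mono_set Ioc_subset_Icc_self
  refine ⟨hDi, hae, hlGi, ?_⟩
  have keyr : ∀ a ∈ Ico 0 b, G b + ∫ t in Ioc a b, (D t).toReal ≤ G a := by
    intro a ha
    have hsub : Ioc a b ⊆ Ioc 0 b := Ioc_subset_Ioc_left ha.1
    have h1 : ∫ t in Ioc a b, (D t).toReal = (∫⁻ t in Ioc a b, D t).toReal :=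
      integral_toReal hD.aemeasurable (ae_restrict_of_ae_restrict_of_subset hsub hae)
    have h2 : ∫⁻ t in Ioc a b, D t ≠ ⊤ := ne_top_of_le_ne_top hfin (lintegral_mono_set hsub)
    have h3 := ENNReal.toReal_mono ENNReal.ofReal_ne_top (key a ha)
    rw [ENNReal.toReal_add ENNReal.ofReal_ne_top h2, ENNReal.toReal_ofReal (hG0 _), ENNReal.toReal_ofReal (hG0 _)] at h3
    rw [h1]; exact h3
  have hl'i : IntegrableOn l' (Ioc 0 b) := (hlc.integrableOn_compact isCompact_Icc).mono_set Ioc_subset_Icc_self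
  -- the double integral
  set f : ℝ × ℝ → ℝ := fun p => indicator {p : ℝ × ℝ | p.1 < p.2} (fun p => l' p.1 * (D p.2).toReal) p with hf
  have hfi : Integrable f ((volume.restrict (Ioc 0 b)).prod (volume.restrict (Ioc 0 b))) :=
    (Integrable.mul_prod (f := l') (g := fun t => (D t).toReal) hl'i hDi).indicator
      (measurableSet_lt measurable_fst measurable_snd)
  have swap := integral_integral_swap (f := fun a t => f (a, t)) hfi
  have s1 : ∫ a in Ioc 0 b, ∫ t in Ioc 0 b, f (a, t) = ∫ a in Ioc 0 b, l' a * ∫ t in Ioc a b, (D t).toReal := by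
    apply setIntegral_congr_fun measurableSet_Ioc
    intro a ha
    simp only
    have : (fun t => f (a, t)) = indicator (Ioi a) (fun t => l' a * (D t).toReal) := by
      funext t
      simp only [hf, indicator, mem_ofPred_eq, mem_Ioi]
    rw [this, setIntegral_indicator measurableSet_Ioi, Ioc_inter_Ioi, max_eq_right ha.1.le, integral_const_mul]
  have s2 : ∫ t in Ioc 0 b, ∫ a in Ioc 0 b, f (a, t) = ∫ t in Ioc 0 b, (l t - 1) * (D t).toReal := by
    apply setIntegral_congr_fun measurableSet_Ioc
    intro t ht
    simp only
    have : (fun a => f (a, t)) = indicator (Iio t) (fun a => l' a * (D t).toReal) := by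
      funext a
      simp only [hf, indicator, mem_ofPred_eq, mem_Iio]
    have hset : Ioc 0 b ∩ Iio t = Ioo 0 t := by
      ext x; simp only [mem_inter_iff, mem_Ioc, mem_Iio, mem_Ioo]
      constructor
      · rintro ⟨⟨h1, _⟩, h3⟩; exact ⟨h1, h3⟩
      · rintro ⟨h1, h2⟩; exact ⟨⟨h1, h2.le.trans ht.2⟩, h2⟩
    rw [this, setIntegral_indicator measurableSet_Iio, hset, integral_mul_const, ← integral_Ioc_eq_integral_Ioo,
      ← intervalIntegral.integral_of_le ht.1.le, intervalIntegral.integral_eq_sub_of_hasDerivAt (f := l), hl0]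
    · intro x hx
      rw [uIcc_of_le ht.1.le] at hx
      exact hl x ⟨hx.1, hx.2.trans ht.2⟩
    · exact (hlc.mono (Icc_subset_Icc_right ht.2)).intervalIntegrable_of_Icc ht.1.le
  have i1 : IntegrableOn (fun a => l' a * ∫ t in Ioc a b, (D t).toReal) (Ioc 0 b) := by
    have := hfi.integral_prod_left
    refine IntegrableOn.congr_fun (f := fun a => ∫ t in Ioc 0 b, f (a, t)) this ?_ measurableSet_Ioc
    intro a ha
    simp only
    have : (fun t => f (a, t)) = indicator (Ioi a) (fun t => l' a * (D t).toReal) := by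
      funext t
      simp only [hf, indicator, mem_ofPred_eq, mem_Ioi]
    rw [this, setIntegral_indicator measurableSet_Ioi, Ioc_inter_Ioi, max_eq_right ha.1.le, integral_const_mul]
  have s3 : ∫ a in Ioc 0 b, (l' a * G b + l' a * ∫ t in Ioc a b, (D t).toReal) ≤ ∫ a in Ioc 0 b, l' a * G a := by
    apply setIntegral_mono_on ((hl'i.mul_const _).add i1) hlGi measurableSet_Ioc
    intro a ha
    have h1 := hl' a (Ioc_subset_Icc_self ha)
    rcases ha.2.eq_or_lt with rfl | hab
    · simp
    · have := mul_le_mul_of_nonneg_left (keyr a ⟨ha.1.le, hab⟩) h1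
      show l' a * G b + l' a * ∫ t in Ioc a b, (D t).toReal ≤ l' a * G a
      linarith
  rw [integral_add (hl'i.mul_const _) i1, integral_mul_const, ← s1, swap, s2,
    ← intervalIntegral.integral_of_le hb.le, intervalIntegral.integral_eq_sub_of_hasDerivAt (f := l)
      (fun x hx => hl x (by rwa [uIcc_of_le hb.le] at hx)) (hlc.intervalIntegrable_of_Icc hb.le), hl0] at s3
  have hlD : IntegrableOn (fun t => l t * (D t).toReal) (Ioc 0 b) := by
    have : IntegrableOn (fun t => (D t).toReal) (Icc 0 b) := by
      rw [integrableOn_Icc_iff_integrableOn_Ioc]; exact hDi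
    exact (this.continuousOn_mul hlcont isCompact_Icc).mono_set Ioc_subset_Icc_self
  have s4 : ∫ t in Ioc 0 b, (l t - 1) * (D t).toReal = (∫ t in Ioc 0 b, l t * (D t).toReal) - ∫ t in Ioc 0 b, (D t).toReal := by
    rw [← integral_sub hlD hDi]
    congr 1; funext t; ring
  have k0 := keyr 0 ⟨le_rfl, hb⟩
  rw [s4] at s3
  linarith

namespace Sol
variable {N : ℕ} {m T : ℝ} {u v vr ut : ℝ → ℝ → ℝ}

/-- the cross density -/
noncomputable def jj (N : ℕ) (m : ℝ) (u ut : ℝ → ℝ → ℝ) (t r : ℝ) : ℝ := u r t ^ m * ut r t * Sw N r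
/-- the mass density -/
noncomputable def ff (N : ℕ) (m : ℝ) (u : ℝ → ℝ → ℝ) (t r : ℝ) : ℝ := u r t ^ (m + 1) * Sw N r

lemma jj_meas (h : Sol N m T u v vr ut) : Measurable (fun p : ℝ × ℝ => jj N m u ut p.1 p.2) := by
  unfold jj
  have m1 : Measurable (fun p : ℝ × ℝ => u p.2 p.1) := h.cu.measurable.comp measurable_swap
  have m2 : Measurable (fun p : ℝ × ℝ => ut p.2 p.1) := h.mesut.comp measurable_swap
  have m3 : Measurable (fun p : ℝ × ℝ => Sw N p.2) := (Sw_cont N).measurable.comp measurable_snd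
  exact ((m1.pow_const _).mul m2).mul m3

lemma ff_meas (h : Sol N m T u v vr ut) : Measurable (fun p : ℝ × ℝ => ff N m u p.1 p.2) := by
  unfold ff
  have m1 : Measurable (fun p : ℝ × ℝ => u p.2 p.1) := h.cu.measurable.comp measurable_swap
  have m3 : Measurable (fun p : ℝ × ℝ => Sw N p.2) := (Sw_cont N).measurable.comp measurable_snd
  exact (m1.pow_const _).mul m3

lemma ff_int (h : Sol N m T u v vr ut) {t : ℝ} (ht : t ∈ Ico 0 T) :
    IntegrableOn (fun r => ff N m u t r) (Ioi 0) := by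
  obtain ⟨C, η, hC, hη, -, -, b3⟩ := h.ph_bound
  have g : IntegrableOn (fun r => C * Real.exp (-η * r)) (Ioi 0) := (integrableOn_exp_mul_Ioi (by linarith) 0).const_mul C
  refine g.mono' (h.ff_meas.comp (measurable_prodMk_left (x := t))).aestronglyMeasurable ?_
  filter_upwards [ae_restrict_mem measurableSet_Ioi] with r hr
  have := h.un r t; have := Sw_nonneg N (le_of_lt hr)
  rw [Real.norm_of_nonneg (by unfold ff; positivity)]
  exact b3 r (le_of_lt hr) t ht

lemma ff_prod_int (h : Sol N m T u v vr ut) {b : ℝ} (hb : b < T) :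
    Integrable (fun p : ℝ × ℝ => ff N m u p.1 p.2) ((volume.restrict (Ioc 0 b)).prod (volume.restrict (Ioi 0))) := by
  obtain ⟨C, η, hC, hη, -, -, b3⟩ := h.ph_bound
  have g : IntegrableOn (fun r => C * Real.exp (-η * r)) (Ioi 0) := (integrableOn_exp_mul_Ioi (by linarith) 0).const_mul C
  have g1 : IntegrableOn (fun _ : ℝ => (1:ℝ)) (Ioc 0 b) := by simp
  have g2 := Integrable.mul_prod g1 g
  refine g2.mono' h.ff_meas.aestronglyMeasurable ?_
  rw [Measure.prod_restrict]
  filter_upwards [ae_restrict_mem (measurableSet_Ioc.prod measurableSet_Ioi)] with p hp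
  have := h.un p.2 p.1; have := Sw_nonneg N (le_of_lt hp.2)
  rw [Real.norm_of_nonneg (by unfold ff; positivity), one_mul]
  exact b3 p.2 (le_of_lt hp.2) p.1 ⟨hp.1.1.le, hp.1.2.trans_lt hb⟩

lemma rpow_sq {x m : ℝ} (hx : 0 < x) : x ^ (m - 1) * x = x ^ m ∧ x ^ (m - 1) * x ^ 2 = x ^ (m + 1) := by
  have h1 : x ^ (m - 1) * x = x ^ m := by rw [← Real.rpow_add_one hx.ne']; congr 1; ring
  refine ⟨h1, ?_⟩
  rw [sq, ← mul_assoc, h1, ← Real.rpow_add_one hx.ne']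

lemma jj_le (h : Sol N m T u v vr ut) {t r : ℝ} (ht : t ∈ Ioo 0 T) (hr : 0 ≤ r) :
    |jj N m u ut t r| ≤ 1 / (2 * m) * dd N m u ut t r + 1 / 2 * ff N m u t r := by
  have hu := h.pos r hr t ht
  have hm := h.m0
  obtain ⟨e1, e2⟩ := rpow_sq (m := m) hu
  have hS := Sw_nonneg N hr
  unfold jj dd ff
  rw [← e1, ← e2]
  have hp : 0 ≤ u r t ^ (m - 1) * Sw N r := by positivity
  have e3 : 1 / (2 * m) * (m * u r t ^ (m - 1) * ut r t ^ 2 * Sw N r) = 1 / 2 * ut r t ^ 2 * (u r t ^ (m - 1) * Sw N r) := by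
    field_simp
  rw [e3, abs_le]
  constructor
  · nlinarith [mul_nonneg hp (sq_nonneg (u r t + ut r t))]
  · nlinarith [mul_nonneg hp (sq_nonneg (u r t - ut r t))]

lemma dd_int_of (h : Sol N m T u v vr ut) {t : ℝ} (hD : De N m u ut t < ⊤) :
    IntegrableOn (fun r => dd N m u ut t r) (Ioi 0) ∧ 
      ∫ r in Ioi (0:ℝ), dd N m u ut t r = (De N m u ut t).toReal := by
  have hm : AEStronglyMeasurable (fun r => dd N m u ut t r) (volume.restrict (Ioi 0)) :=
    (h.dd_meas.comp (measurable_prodMk_left (x := t))).aestronglyMeasurable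
  have hnn : ∀ᵐ r ∂volume.restrict (Ioi (0:ℝ)), 0 ≤ dd N m u ut t r := by
    filter_upwards [ae_restrict_mem measurableSet_Ioi] with r hr
    exact h.dd_nonneg t (le_of_lt hr)
  refine ⟨⟨hm, ?_⟩, ?_⟩
  · rw [hasFiniteIntegral_iff_ofReal hnn]; exact hD
  · exact integral_eq_lintegral_of_nonneg_ae hnn hm

lemma jj_int_of (h : Sol N m T u v vr ut) {t : ℝ} (ht : t ∈ Ioo 0 T) (hD : De N m u ut t < ⊤) :
    IntegrableOn (fun r => jj N m u ut t r) (Ioi 0) := by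
  have g := (((h.dd_int_of hD).1.const_mul (1 / (2 * m))).add ((h.ff_int (Ioo_subset_Ico_self ht)).const_mul (1 / 2)))
  refine g.mono' (h.jj_meas.comp (measurable_prodMk_left (x := t))).aestronglyMeasurable ?_
  filter_upwards [ae_restrict_mem measurableSet_Ioi] with r hr
  exact h.jj_le ht (le_of_lt hr)

lemma jj_eq (h : Sol N m T u v vr ut) {t : ℝ} (ht : t ∈ Ioo 0 T) (hD : De N m u ut t < ⊤) :
    ∫ r in Ioi (0:ℝ), jj N m u ut t r = - 2 * Gr N v t := by
  have htI := Ioo_subset_Ico_self ht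
  obtain ⟨g1, g2⟩ := h.gr_eq ht
  have j1 := h.jj_int_of ht hD
  set P : ℝ → ℝ := fun r => v r t * (Sw N r * vr r t) with hP
  set P' : ℝ → ℝ := fun r => 2 * (1 / 2 * vr r t ^ 2 * Sw N r) + jj N m u ut t r with hP'
  have hd : ∀ r ∈ Ioi (0:ℝ), HasDerivAt P (P' r) r := by
    intro r hr
    refine ((h.dv r hr t ht).mul (h.dflux r hr t ht)).congr_deriv ?_
    simp only [hP', jj, h.veq]; ring
  have hP'i : IntegrableOn P' (Ioi 0) := (g1.const_mul 2).add j1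
  have hPc : ContinuousOn P (Ici 0) :=
    (h.cv_r t).continuousOn.mul ((Sw_cont N).continuousOn.mul (h.cvr_r ht))
  have hPi : IntegrableOn P (Ioi 0) := by
    have hv2 := (h.h1 t htI).2.1
    have g : IntegrableOn (fun r => 1 / 2 * (v r t ^ 2 * Real.sinh r ^ (N - 1)) + (1 / 2 * vr r t ^ 2 * Sw N r)) (Ioi 0) :=
      (hv2.const_mul _).add g1
    refine g.mono' ((hPc.mono Ioi_subset_Ici_self).aestronglyMeasurable measurableSet_Ioi) ?_
    filter_upwards [ae_restrict_mem measurableSet_Ioi] with r hr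
    have hS := Sw_nonneg N (le_of_lt hr)
    show |v r t * (Sw N r * vr r t)| ≤ 1 / 2 * (v r t ^ 2 * Sw N r) + 1 / 2 * vr r t ^ 2 * Sw N r
    rw [abs_le]
    constructor
    · nlinarith [mul_nonneg hS (sq_nonneg (v r t + vr r t))]
    · nlinarith [mul_nonneg hS (sq_nonneg (v r t - vr r t))]
  have lim := tendsto_zero_of_hasDerivAt_of_integrableOn_Ioi hd hP'i hPi
  have := integral_Ioi_of_hasDerivAt_of_tendsto (hPc 0 self_mem_Ici) hd hP'i lim
  have hP0 : P 0 = 0 := by simp [hP, Sw_zero h.hN]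
  rw [hP0, hP', integral_add (g1.const_mul 2) j1, integral_const_mul, g2] at this
  linarith

end Sol

namespace Sol
variable {N : ℕ} {m T : ℝ} {u v vr ut : ℝ → ℝ → ℝ}

lemma De_fin (h : Sol N m T u v vr ut) {b : ℝ} (hb0 : 0 < b) (hb : b < T) :
    ∫⁻ t in Ioc 0 b, De N m u ut t ≠ ⊤ := by
  have := h.step4 ⟨le_rfl, h.T0⟩ hb0 hb
  exact ne_top_of_le_ne_top ENNReal.ofReal_ne_top (le_add_self.trans this)

lemma dd_prod_int (h : Sol N m T u v vr ut) {b : ℝ} (hb0 : 0 < b) (hb : b < T) :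
    Integrable (fun p : ℝ × ℝ => dd N m u ut p.1 p.2) ((volume.restrict (Ioc 0 b)).prod (volume.restrict (Ioi 0))) := by
  refine ⟨h.dd_meas.aestronglyMeasurable, ?_⟩
  rw [hasFiniteIntegral_iff_ofReal, lintegral_prod _ h.dd_meas.ennreal_ofReal.aemeasurable]
  · exact lt_top_iff_ne_top.2 (h.De_fin hb0 hb)
  · rw [Measure.prod_restrict]
    filter_upwards [ae_restrict_mem (measurableSet_Ioc.prod measurableSet_Ioi)] with p hp
    exact h.dd_nonneg _ (le_of_lt hp.2)

lemma jj_prod_int (h : Sol N m T u v vr ut) {b : ℝ} (hb0 : 0 < b) (hb : b < T) :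
    Integrable (fun p : ℝ × ℝ => jj N m u ut p.1 p.2) ((volume.restrict (Ioc 0 b)).prod (volume.restrict (Ioi 0))) := by
  have g := ((h.dd_prod_int hb0 hb).const_mul (1 / (2 * m))).add ((h.ff_prod_int hb).const_mul (1 / 2))
  refine g.mono' h.jj_meas.aestronglyMeasurable ?_
  rw [Measure.prod_restrict]
  filter_upwards [ae_restrict_mem (measurableSet_Ioc.prod measurableSet_Ioi)] with p hp
  exact h.jj_le ⟨hp.1.1, hp.1.2.trans_lt hb⟩ (le_of_lt hp.2)

lemma prod_bdd {b : ℝ} {g : ℝ → ℝ} (hg : ContinuousOn g (Icc 0 b)) {f : ℝ × ℝ → ℝ}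
    (hf : Integrable f ((volume.restrict (Ioc 0 b)).prod (volume.restrict (Ioi 0)))) :
    Integrable (fun p : ℝ × ℝ => g p.1 * f p) ((volume.restrict (Ioc 0 b)).prod (volume.restrict (Ioi 0))) := by
  obtain ⟨C, hC⟩ := isCompact_Icc.exists_bound_of_continuousOn hg
  have hm : AEStronglyMeasurable g (volume.restrict (Ioc 0 b)) :=
    (hg.mono Ioc_subset_Icc_self).aestronglyMeasurable measurableSet_Ioc
  refine hf.bdd_mul (c := C) hm.comp_fst ?_
  rw [Measure.prod_restrict]
  filter_upwards [ae_restrict_mem (measurableSet_Ioc.prod measurableSet_Ioi)] with p hp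
  exact hC _ (Ioc_subset_Icc_self hp.1)

/-- weighted time evolution of the mass -/
lemma F_identity (h : Sol N m T u v vr ut) {b : ℝ} (hb0 : 0 < b) (hb : b < T) {μ μ' : ℝ → ℝ}
    (hμ : ∀ t ∈ Icc 0 b, HasDerivAt μ (μ' t) t) (hμ' : ContinuousOn μ' (Icc 0 b)) :
    IntegrableOn (fun t => μ' t * (∫ r in Ioi (0:ℝ), ff N m u t r)) (Ioc 0 b) ∧
    μ b * (∫ r in Ioi (0:ℝ), ff N m u b r) - μ 0 * (∫ r in Ioi (0:ℝ), ff N m u 0 r)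
      = ∫ t in Ioc 0 b, (μ' t * (∫ r in Ioi (0:ℝ), ff N m u t r) + (m + 1) * μ t * (-2 * Gr N v t)) := by
  have hμc : ContinuousOn μ (Icc 0 b) := fun t ht => (hμ t ht).continuousAt.continuousWithinAt
  have i1 := prod_bdd hμ' (h.ff_prod_int hb)
  have i2 := prod_bdd (hμc.const_mul (m + 1)) (h.jj_prod_int hb0 hb)
  have hae : ∀ᵐ t ∂volume.restrict (Ioc 0 b), De N m u ut t < ⊤ := ae_lt_top h.De_meas (h.De_fin hb0 hb)
  refine ⟨?_, ?_⟩
  · have := i1.integral_prod_left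
    simp only [integral_const_mul] at this
    exact this
  have i3 := i1.add i2
  have swap := integral_integral_swap
    (f := fun t r => μ' t * ff N m u t r + (m + 1) * μ t * jj N m u ut t r) i3
  have e1 : ∫ t in Ioc 0 b, (μ' t * (∫ r in Ioi (0:ℝ), ff N m u t r) + (m + 1) * μ t * (-2 * Gr N v t))
      = ∫ t in Ioc 0 b, ∫ r in Ioi (0:ℝ), (μ' t * ff N m u t r + (m + 1) * μ t * jj N m u ut t r) := by
    apply integral_congr_ae
    filter_upwards [hae, ae_restrict_mem measurableSet_Ioc] with t hD ht
    have htT : t ∈ Ioo 0 T := ⟨ht.1, ht.2.trans_lt hb⟩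
    rw [integral_add ((h.ff_int (Ioo_subset_Ico_self htT)).const_mul _) ((h.jj_int_of htT hD).const_mul _),
      integral_const_mul, integral_const_mul, h.jj_eq htT hD]
  have e2 : ∫ r in Ioi (0:ℝ), ∫ t in Ioc 0 b, (μ' t * ff N m u t r + (m + 1) * μ t * jj N m u ut t r)
      = ∫ r in Ioi (0:ℝ), (μ b * ff N m u b r - μ 0 * ff N m u 0 r) := by
    apply integral_congr_ae
    filter_upwards [i3.prod_left_ae, ae_restrict_mem measurableSet_Ioi] with r hi hr
    have hr0 : (0:ℝ) ≤ r := le_of_lt hr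
    rw [← intervalIntegral.integral_of_le hb0.le,
      intervalIntegral.integral_eq_sub_of_hasDerivAt_of_le (f := fun t => μ t * ff N m u t r) hb0.le]
    · apply hμc.mul
      unfold ff
      apply ContinuousOn.mul _ continuousOn_const
      exact ((h.cu_t r).rpow_const (fun x => Or.inr (by linarith [h.m0]))).continuousOn
    · intro t ht
      have htT : t ∈ Ioo 0 T := ⟨ht.1, ht.2.trans hb⟩
      have d1 := (h.du r hr0 t htT).rpow_const (p := m + 1) (Or.inl (h.pos r hr0 t htT).ne')
      refine ((hμ t (Ioo_subset_Icc_self ht)).mul (d1.mul_const (Sw N r))).congr_deriv ?_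
      simp only [ff, jj, add_sub_cancel_right]; ring
    · rw [intervalIntegrable_iff_integrableOn_Ioc_of_le hb0.le]
      exact hi
  rw [e1, swap, e2, integral_sub ((h.ff_int ⟨hb0.le, hb⟩).const_mul _) ((h.ff_int ⟨le_rfl, h.T0⟩).const_mul _),
    integral_const_mul, integral_const_mul]

/-- completed-square density -/
noncomputable def qq (N : ℕ) (m T : ℝ) (u ut : ℝ → ℝ → ℝ) (t r : ℝ) : ℝ :=
  u r t ^ (m - 1) * (ut r t + u r t / ((1 - m) * (T - t))) ^ 2 * Sw N r

lemma qq_eq (h : Sol N m T u v vr ut) {t : ℝ} (ht : t ∈ Ioo 0 T) (hD : De N m u ut t < ⊤) :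
    m * ∫ r in Ioi (0:ℝ), qq N m T u ut t r = (De N m u ut t).toReal
      + 2 * m / ((1 - m) * (T - t)) * (-2 * Gr N v t)
      + m / ((1 - m) * (T - t)) ^ 2 * ∫ r in Ioi (0:ℝ), ff N m u t r := by
  obtain ⟨d1, d2⟩ := h.dd_int_of hD
  have j := h.jj_int_of ht hD
  have f := h.ff_int (Ioo_subset_Ico_self ht)
  have g1 : IntegrableOn (fun r => dd N m u ut t r + 2 * m / ((1 - m) * (T - t)) * jj N m u ut t r) (Ioi 0) :=
    d1.add (j.const_mul _)
  rw [← d2, ← h.jj_eq ht hD, ← integral_const_mul, ← integral_const_mul, ← integral_const_mul,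
    ← integral_add d1 (j.const_mul _), ← integral_add g1 (f.const_mul _)]
  apply setIntegral_congr_fun measurableSet_Ioi
  intro r hr
  have hu := h.pos r (le_of_lt hr) t ht
  obtain ⟨e1, e2⟩ := rpow_sq (m := m) hu
  simp only [qq, dd, jj, ff]
  rw [← e1, ← e2]
  have : (1 - m) * (T - t) ≠ 0 := mul_ne_zero (by linarith [h.m1]) (by linarith [ht.2])
  generalize (1 - m) * (T - t) = k at this
  field_simp
  ring

/-- weight -/
noncomputable def la (m T t : ℝ) : ℝ := Real.exp (2 * m / (1 - m) * (Real.log T - Real.log (T - t)))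

lemma la_deriv {t : ℝ} (ht : t < T) :
    HasDerivAt (la m T) (2 * m / (1 - m) * (la m T t / (T - t))) t := by
  unfold la
  have h1 : HasDerivAt (fun t => T - t) (-1) t := by simpa using (hasDerivAt_id t).const_sub T
  have h2 := h1.log (by linarith : T - t ≠ 0)
  refine ((h2.const_sub (Real.log T)).const_mul (2 * m / (1 - m))).exp.congr_deriv ?_
  ring

lemma mu_deriv (hm : m < 1) {t : ℝ} (ht : t < T) :
    HasDerivAt (fun t => la m T t / (T - t)) ((1 + m) / (1 - m) * (la m T t / (T - t) ^ 2)) t := by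
  have h1 : HasDerivAt (fun t => T - t) (-1) t := by simpa using (hasDerivAt_id t).const_sub T
  have hn : T - t ≠ 0 := by linarith
  refine ((la_deriv ht).div h1 hn).congr_deriv ?_
  have : 1 - m ≠ 0 := by linarith
  field_simp
  ring

lemma main_sol (h : Sol N m T u v vr ut) {b : ℝ} (hb0 : 0 < b) (hb : b < T) :
    la m T b * Gr N v b - m / (1 - m ^ 2) * (la m T b / (T - b)) * (∫ r in Ioi (0:ℝ), ff N m u b r)
      + m * ∫ t in Ioc 0 b, la m T t * ∫ r in Ioi (0:ℝ), qq N m T u ut t r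
    ≤ Gr N v 0 - m / (1 - m ^ 2) * (1 / T) * (∫ r in Ioi (0:ℝ), ff N m u 0 r) := by
  have hm0 := h.m0; have hm1 := h.m1; have hT := h.T0
  have lt : ∀ t ∈ Icc 0 b, t < T := fun t ht => ht.2.trans_lt hb
  have la0 : la m T 0 = 1 := by simp [la]
  have lc : ContinuousOn (la m T) (Icc 0 b) := fun t ht => (la_deriv (lt t ht)).continuousAt.continuousWithinAt
  have mc : ContinuousOn (fun t => la m T t / (T - t)) (Icc 0 b) :=
    fun t ht => (mu_deriv hm1 (lt t ht)).continuousAt.continuousWithinAt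
  have m'c : ContinuousOn (fun t => (1 + m) / (1 - m) * (la m T t / (T - t) ^ 2)) (Icc 0 b) := by
    apply ContinuousOn.mul continuousOn_const
    apply lc.div (by fun_prop)
    intro t ht
    have := lt t ht
    exact pow_ne_zero _ (by linarith)
  obtain ⟨f1, f2⟩ := h.F_identity hb0 hb (fun t ht => mu_deriv hm1 (lt t ht)) m'c
  obtain ⟨t1, t2, t3, t4⟩ := tonelli_weight hb0 h.De_meas (fun t => gr_nonneg v t)
    (h.gr_anti.mono (fun t ht => ⟨ht.1, lt t ht⟩)) (fun t ht => la_deriv (lt t ht)) la0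
    (mc.const_mul (2 * m / (1 - m))) (fun t ht => by
      have := lt t ht
      have h1 : 0 < T - t := by linarith
      have h2 : 0 < 1 - m := by linarith
      unfold la
      positivity) (fun a ha => h.step4 ⟨ha.1, ha.2.trans hb⟩ ha.2 hb)
  have iD : IntegrableOn (fun t => la m T t * (De N m u ut t).toReal) (Ioc 0 b) := by
    have : IntegrableOn (fun t => (De N m u ut t).toReal) (Icc 0 b) := by
      rw [integrableOn_Icc_iff_integrableOn_Ioc]; exact t1
    exact (this.continuousOn_mul lc isCompact_Icc).mono_set Ioc_subset_Icc_self
  have hn1 : 1 - m ≠ 0 := by linarith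
  have hn2 : 1 + m ≠ 0 := by linarith
  have hn3 : 1 - m ^ 2 ≠ 0 := by
    have : 1 - m ^ 2 = (1 - m) * (1 + m) := by ring
    rw [this]; exact mul_ne_zero hn1 hn2
  -- integral of Q
  have eQ : m * ∫ t in Ioc 0 b, la m T t * ∫ r in Ioi (0:ℝ), qq N m T u ut t r
      = ∫ t in Ioc 0 b, (la m T t * (De N m u ut t).toReal
        + (m / (1 - m ^ 2) * ((1 + m) / (1 - m) * (la m T t / (T - t) ^ 2) * (∫ r in Ioi (0:ℝ), ff N m u t r)
          + (m + 1) * (la m T t / (T - t)) * (-2 * Gr N v t))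
        - 2 * m / (1 - m) * (la m T t / (T - t)) * Gr N v t)) := by
    rw [← integral_const_mul]
    apply integral_congr_ae
    filter_upwards [t2, ae_restrict_mem measurableSet_Ioc] with t hD ht
    have htT : t ∈ Ioo 0 T := ⟨ht.1, ht.2.trans_lt hb⟩
    have hn4 : T - t ≠ 0 := by linarith [htT.2]
    have := h.qq_eq htT hD
    rw [mul_left_comm, this]
    have e : 1 - m ^ 2 = (1 - m) * (1 + m) := by ring
    rw [e]
    field_simp
    ring
  have iG : IntegrableOn (fun t => (m + 1) * (la m T t / (T - t)) * (-2 * Gr N v t)) (Ioc 0 b) := by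
    have := t3.const_mul (-(m + 1) * (1 - m) / m)
    refine this.congr (Eventually.of_forall fun t => ?_)
    simp only
    field_simp
  have iF : IntegrableOn (fun t => m / (1 - m ^ 2) *
      ((1 + m) / (1 - m) * (la m T t / (T - t) ^ 2) * (∫ r in Ioi (0:ℝ), ff N m u t r)
          + (m + 1) * (la m T t / (T - t)) * (-2 * Gr N v t))) (Ioc 0 b) :=
    (f1.add iG).const_mul (m / (1 - m ^ 2))
  have iH : IntegrableOn (fun t => m / (1 - m ^ 2) *
      ((1 + m) / (1 - m) * (la m T t / (T - t) ^ 2) * (∫ r in Ioi (0:ℝ), ff N m u t r)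
          + (m + 1) * (la m T t / (T - t)) * (-2 * Gr N v t))
      - 2 * m / (1 - m) * (la m T t / (T - t)) * Gr N v t) (Ioc 0 b) := iF.sub t3
  rw [la0] at f2
  simp only [sub_zero] at f2
  rw [eQ, integral_add iD iH, integral_sub iF t3, integral_const_mul, ← f2]
  have : ∀ x y z w : ℝ, x * (y * z - 1 / T * w) = x * y * z - x * (1 / T) * w := by intros; ring
  rw [this]
  linarith

end Sol

lemma memH1_congr {N : ℕ} {f g : ℝ → ℝ} (h : EqOn f g (Ioi 0)) (hg : MemH1rad N g) : MemH1rad N f := by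
  have hd : EqOn (deriv f) (deriv g) (Ioi 0) := by
    intro x hx
    exact (h.eventuallyEq_of_mem (Ioi_mem_nhds hx)).deriv_eq
  refine ⟨?_, ?_, ?_⟩
  · intro a b ha hab
    rw [h (mem_Ioi.2 (ha.trans_le hab)), h (mem_Ioi.2 ha), hg.1 a b ha hab]
    apply intervalIntegral.integral_congr
    intro x hx
    rw [uIcc_of_le hab] at hx
    exact (hd (mem_Ioi.2 (ha.trans_le hx.1))).symm
  · refine hg.2.1.congr_fun ?_ measurableSet_Ioi
    intro x hx; simp only [h hx]
  · refine hg.2.2.congr_fun ?_ measurableSet_Ioi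
    intro x hx; simp only [hd hx]

lemma mkSol (N : ℕ) (hN : 2 ≤ N) (m T : ℝ) (hm0 : 0 < m) (hm1 : m < 1) (hT : 0 < T)
    (u : ℝ → ℝ → ℝ) (hu : IsRadialEnergySolution N m T u) :
    ∃ U v vr ut : ℝ → ℝ → ℝ, Sol N m T U v vr ut ∧ ∀ r, 0 ≤ r → ∀ t ∈ Icc 0 T, U r t = u r t := by
  set K : Set (ℝ × ℝ) := Ici 0 ×ˢ Ioo 0 T with hK
  set f : ℝ × ℝ → ℝ := fun p => u p.1 p.2 with hf
  set g : ℝ × ℝ → ℝ := fun p => u p.1 p.2 ^ m with hg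
  have hKu : UniqueDiffOn ℝ K := (uniqueDiffOn_Ici 0).prod isOpen_Ioo.uniqueDiffOn
  have fs : ContDiffOn ℝ (⊤ : ℕ∞) f K := hu.smooth
  have gs : ContDiffOn ℝ (⊤ : ℕ∞) g K :=
    fs.rpow_const_of_ne (fun p hp => (hu.pos p.1 hp.1 p.2 hp.2).ne')
  set U : ℝ → ℝ → ℝ := fun r t => u (max r 0) (max 0 (min t T)) with hU
  have Ueq : ∀ r, 0 ≤ r → ∀ t ∈ Icc 0 T, U r t = u r t := by
    intro r hr t ht
    simp only [hU]
    rw [max_eq_left hr, min_eq_left ht.2, max_eq_right ht.1]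
  have clampmem : ∀ t, max 0 (min t T) ∈ Icc 0 T := fun t =>
    ⟨le_max_left _ _, max_le hT.le (min_le_right _ _)⟩
  have cU : Continuous (fun p : ℝ × ℝ => U p.1 p.2) :=
    hu.continuousOn.comp_continuous (f := fun p : ℝ × ℝ => (max p.1 0, max 0 (min p.2 T))) (by fun_prop)
      (fun p => ⟨mem_Ici.2 (le_max_right _ _), clampmem _⟩)
  have Un : ∀ r t, 0 ≤ U r t := fun r t => hu.nonneg _ (mem_Ici.2 (le_max_right _ _)) _ (clampmem _)
  have hKn : ∀ r, 0 < r → ∀ t ∈ Ioo 0 T, K ∈ 𝓝 (r, t) := fun r hr t ht =>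
    prod_mem_nhds (Ici_mem_nhds hr) (Ioo_mem_nhds ht.1 ht.2)
  have dg : ∀ r, 0 < r → ∀ t ∈ Ioo 0 T,
      HasDerivAt (fun ρ => u ρ t ^ m) (fderivWithin ℝ g K (r, t) (1, 0)) r := by
    intro r hr t ht
    have h1 : DifferentiableWithinAt ℝ g K (r, t) := (gs.differentiableOn (by simp)) _ ⟨hr.le, ht⟩
    have h2 := h1.hasFDerivWithinAt.hasFDerivAt (hKn r hr t ht)
    have h3 : HasDerivAt (fun ρ : ℝ => ((ρ, t) : ℝ × ℝ)) (1, 0) r :=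
      (hasDerivAt_id r).prodMk (hasDerivAt_const r t)
    exact h2.comp_hasDerivAt r h3
  have df : ∀ r, 0 ≤ r → ∀ t ∈ Ioo 0 T,
      HasDerivAt (fun t => u r t) (fderivWithin ℝ f K (r, t) (0, 1)) t := by
    intro r hr t ht
    have h1 : DifferentiableWithinAt ℝ f K (r, t) := (fs.differentiableOn (by simp)) _ ⟨hr, ht⟩
    have h3 : HasDerivAt (fun t : ℝ => ((r, t) : ℝ × ℝ)) (0, 1) t :=
      (hasDerivAt_const t r).prodMk (hasDerivAt_id t)
    have h4 := h1.hasFDerivWithinAt.comp_hasDerivWithinAt t (h3.hasDerivWithinAt (s := Ioo 0 T))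
      (fun x hx => ⟨hr, hx⟩)
    exact h4.hasDerivAt (Ioo_mem_nhds ht.1 ht.2)
  have cvr : ContinuousOn (fun p : ℝ × ℝ => fderivWithin ℝ g K p (1, 0)) K :=
    (gs.continuousOn_fderivWithin hKu (by simp)).clm_apply continuousOn_const
  have cut : ContinuousOn (fun p : ℝ × ℝ => fderivWithin ℝ f K p (0, 1)) K :=
    (fs.continuousOn_fderivWithin hKu (by simp)).clm_apply continuousOn_const
  have hKm : MeasurableSet K := measurableSet_Ici.prod measurableSet_Ioo
  set ut : ℝ → ℝ → ℝ := fun r t => indicator K (fun p => fderivWithin ℝ f K p (0, 1)) (r, t) with hut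
  have ute : ∀ r, 0 ≤ r → ∀ t ∈ Ioo 0 T, ut r t = fderivWithin ℝ f K (r, t) (0, 1) := by
    intro r hr t ht
    exact indicator_of_mem (s := K) (show (r, t) ∈ K from ⟨hr, ht⟩) _
  refine ⟨U, fun r t => U r t ^ m, fun r t => fderivWithin ℝ g K (r, t) (1, 0), ut, ?_, Ueq⟩
  refine ⟨hN, hm0, hm1, hT, cU, ?_, Un, fun _ _ => rfl, ?_, cvr, ?_, ?_, ?_, ?_, ?_, ?_⟩
  · exact cU.rpow_const (fun x => Or.inr hm0.le)
  · intro r hr t ht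
    rw [Ueq r hr t (Ioo_subset_Icc_self ht)]
    exact hu.pos r hr t ht
  · refine cut.congr ?_
    intro p hp
    exact ute p.1 hp.1 p.2 hp.2
  · intro r hr t ht
    refine (dg r hr t ht).congr_of_eventuallyEq ?_
    filter_upwards [Ioi_mem_nhds hr] with ρ hρ
    rw [Ueq ρ (le_of_lt hρ) t (Ioo_subset_Icc_self ht)]
  · intro r hr t ht
    rw [ute r hr t ht]
    refine (df r hr t ht).congr_of_eventuallyEq ?_
    filter_upwards [Ioo_mem_nhds ht.1 ht.2] with s hs
    exact Ueq r hr s (Ioo_subset_Icc_self hs)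
  · intro r hr t ht
    have hc : ContDiffOn ℝ (⊤ : ℕ∞) (fun ρ => u ρ t ^ m) (Ioi 0) :=
      gs.comp (f := fun ρ : ℝ => ((ρ, t) : ℝ × ℝ)) (by fun_prop) (fun ρ hρ => ⟨mem_Ici.2 (le_of_lt (mem_Ioi.1 hρ)), ht⟩)
    have hc1 : ContDiffOn ℝ 1 (deriv (fun ρ => u ρ t ^ m)) (Ioi 0) :=
      hc.deriv_of_isOpen isOpen_Ioi (by norm_cast)
    have hd : DifferentiableAt ℝ (deriv (fun ρ => u ρ t ^ m)) r :=
      (hc1.differentiableOn (by simp)).differentiableAt (Ioi_mem_nhds hr)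
    have h1 := (Sw_deriv hN r).mul hd.hasDerivAt
    have h2 := hu.pde r hr t ht
    rw [(df r hr.le t ht).deriv, ← ute r hr.le t ht] at h2
    have hs := Real.sinh_pos_iff.2 hr
    have e : HasDerivAt (fun ρ => Sw N ρ * deriv (fun ρ => u ρ t ^ m) ρ) (Sw N r * ut r t) r := by
      refine h1.congr_deriv ?_
      rw [h2]
      have : Sw N r = Real.sinh r ^ (N - 2) * Real.sinh r := by
        unfold Sw; rw [← pow_succ]; congr 1; omega
      rw [this]
      field_simp
      ring
    refine e.congr_of_eventuallyEq ?_
    filter_upwards [Ioi_mem_nhds hr] with ρ hρ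
    rw [(dg ρ hρ t ht).deriv]
  · intro a ha
    have : EqOn (fun ρ => U ρ a ^ m) (fun ρ => u ρ a ^ m) (Ioi 0) := by
      intro r hr
      simp only
      rw [Ueq r (le_of_lt hr) a (Ico_subset_Icc_self ha)]
    refine memH1_congr this ?_
    rcases ha.1.eq_or_lt with h0 | h0
    · rw [← h0]; exact hu.init_energy
    · exact hu.energy a ⟨h0, ha.2⟩
  · show Measurable (indicator K (fun p => fderivWithin ℝ f K p (0, 1)))
    classical
    have : indicator K (fun p => fderivWithin ℝ f K p (0, 1)) =
        K.piecewise (fun p => fderivWithin ℝ f K p (0, 1)) (fun _ => 0) := by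
      funext p; simp [indicator, Set.piecewise]
    rw [this]
    exact cut.measurable_piecewise continuousOn_const hKm

/-- Energy inequality for the rescaled solution. -/
theorem rescaled_energy_inequality
    (N : ℕ) (hN : 2 ≤ N) (m T : ℝ)
    (hm : m ∈ Set.Ioo (((N : ℝ) - 2) / ((N : ℝ) + 2)) 1) (hT : 0 < T)
    (u : ℝ → ℝ → ℝ) (hu : IsRadialEnergySolution N m T u)
    (hRHS : MeasureTheory.IntegrableOn
      (fun s => ((1:ℝ) / 2 * (deriv (fun ρ => u ρ 0 ^ m) s) ^ 2
        - m / ((1 - m ^ 2) * T) * u s 0 ^ (m + 1)) * Real.sinh s ^ (N - 1))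
      (Set.Ioi 0)) :
    ∀ τ > (0:ℝ),
      (∫ s in Set.Ioi (0:ℝ),
          ((1:ℝ) / 2 * (deriv (fun ρ => rescaled m T u ρ τ ^ m) s) ^ 2
            - m / ((1 - m ^ 2) * T) * rescaled m T u s τ ^ (m + 1)) *
            Real.sinh s ^ (N - 1))
        + m * (∫ σ in Set.Ioc (0:ℝ) τ, ∫ s in Set.Ioi (0:ℝ),
            rescaled m T u s σ ^ (m - 1) *
              (deriv (fun σ' => rescaled m T u s σ') σ) ^ 2 *
              Real.sinh s ^ (N - 1))
      ≤ ∫ s in Set.Ioi (0:ℝ),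
          ((1:ℝ) / 2 * (deriv (fun ρ => u ρ 0 ^ m) s) ^ 2
            - m / ((1 - m ^ 2) * T) * u s 0 ^ (m + 1)) * Real.sinh s ^ (N - 1) := by
  have hN2 : (2:ℝ) ≤ N := by exact_mod_cast hN
  have hm0 : 0 < m := lt_of_le_of_lt (div_nonneg (by linarith) (by linarith)) hm.1
  have hm1 : m < 1 := hm.2
  obtain ⟨U, v, vr, ut, h, hUe⟩ := mkSol N hN m T hm0 hm1 hT u hu
  intro τ hτ
  set θ : ℝ → ℝ := fun σ => T - T * Real.exp (-σ / T) with hθ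
  have hθm : ∀ σ, 0 < σ → θ σ ∈ Ioo 0 T := by
    intro σ hσ
    have h1 : Real.exp (-σ / T) < 1 := by
      rw [Real.exp_lt_one_iff]
      exact div_neg_of_neg_of_pos (by linarith) hT
    have h2 := Real.exp_pos (-σ / T)
    constructor
    · simp only [hθ]; nlinarith
    · simp only [hθ]; nlinarith
  have hθd : ∀ σ, HasDerivAt θ (Real.exp (-σ / T)) σ := by
    intro σ
    have h1 : HasDerivAt (fun σ : ℝ => -σ / T) (-1 / T) σ := (hasDerivAt_id σ).neg.div_const T
    refine ((h1.exp.const_mul T).const_sub T).congr_deriv ?_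
    field_simp
  have hθT : ∀ σ, T - θ σ = T * Real.exp (-σ / T) := by intro σ; simp only [hθ]; ring
  have n1 : 1 - m ≠ 0 := by linarith
  have n2 : 1 + m ≠ 0 := by linarith
  have e2 : 1 - m ^ 2 = (1 - m) * (1 + m) := by ring
  have hla : ∀ σ, Sol.la m T (θ σ) = Real.exp (2 * m / (1 - m) * (σ / T)) := by
    intro σ
    unfold Sol.la
    rw [hθT, Real.log_mul hT.ne' (Real.exp_pos _).ne', Real.log_exp]
    congr 1; ring
  have hE : ∀ σ p : ℝ, Real.exp (σ / ((1 - m) * T)) ^ p = Real.exp (σ / ((1 - m) * T) * p) := by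
    intro σ p; rw [← Real.exp_mul]
  have hw : ∀ (r σ p : ℝ), 0 ≤ r → 0 < σ →
      rescaled m T u r σ ^ p = Real.exp (σ / ((1 - m) * T) * p) * U r (θ σ) ^ p := by
    intro r σ p hr hσ
    unfold rescaled
    have : u r (T - T * Real.exp (-σ / T)) = U r (θ σ) := (hUe r hr _ (Ioo_subset_Icc_self (hθm σ hσ))).symm
    rw [this, Real.mul_rpow (Real.exp_pos _).le (h.un _ _), hE]
  set b := θ τ with hbdef
  have hb := hθm τ hτ
  have hmain := h.main_sol hb.1 hb.2
  -- first term
  have hL : (∫ s in Set.Ioi (0:ℝ),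
          ((1:ℝ) / 2 * (deriv (fun ρ => rescaled m T u ρ τ ^ m) s) ^ 2
            - m / ((1 - m ^ 2) * T) * rescaled m T u s τ ^ (m + 1)) *
            Real.sinh s ^ (N - 1)) = Sol.la m T b * Gr N v b
      - m / (1 - m ^ 2) * (Sol.la m T b / (T - b)) * (∫ r in Ioi (0:ℝ), Sol.ff N m U b r) := by
    obtain ⟨g1, g2⟩ := h.gr_eq hb
    rw [← g2, ← integral_const_mul, ← integral_const_mul,
      ← integral_sub (g1.const_mul _) ((h.ff_int (Ioo_subset_Ico_self hb)).const_mul _)]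
    apply setIntegral_congr_fun measurableSet_Ioi
    intro r hr
    have hd : HasDerivAt (fun ρ => rescaled m T u ρ τ ^ m) (Real.exp (τ / ((1 - m) * T) * m) * vr r b) r := by
      refine ((h.dv r hr b hb).const_mul _).congr_of_eventuallyEq ?_
      filter_upwards [Ioi_mem_nhds (mem_Ioi.1 hr)] with ρ hρ
      rw [hw ρ τ m (le_of_lt hρ) hτ, h.veq]
    simp only [hd.deriv, Sol.ff]
    rw [hw r τ (m + 1) (le_of_lt hr) hτ, hla, hθT]
    have x1 : Real.exp (τ / ((1 - m) * T) * m) ^ 2 = Real.exp (2 * m / (1 - m) * (τ / T)) := by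
      rw [← Real.exp_nat_mul]; congr 1; push_cast; field_simp
    have x2 : Real.exp (τ / ((1 - m) * T) * (m + 1)) * Real.exp (-τ / T) = Real.exp (2 * m / (1 - m) * (τ / T)) := by
      rw [← Real.exp_add]; congr 1; field_simp; ring
    rw [mul_pow, x1, ← x2]
    have := (Real.exp_pos (-τ / T)).ne'
    simp only [Sw, ← hbdef]
    generalize Real.exp (-τ / T) = y at *
    rw [e2]
    field_simp
  -- right-hand side
  have hR : (∫ s in Set.Ioi (0:ℝ),
          ((1:ℝ) / 2 * (deriv (fun ρ => u ρ 0 ^ m) s) ^ 2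
            - m / ((1 - m ^ 2) * T) * u s 0 ^ (m + 1)) * Real.sinh s ^ (N - 1))
      = Gr N v 0 - m / (1 - m ^ 2) * (1 / T) * (∫ r in Ioi (0:ℝ), Sol.ff N m U 0 r) := by
    have z : (0:ℝ) ∈ Ico 0 T := ⟨le_rfl, hT⟩
    unfold Gr
    rw [← integral_const_mul, ← integral_sub (h.gr_int z) ((h.ff_int z).const_mul _)]
    apply setIntegral_congr_fun measurableSet_Ioi
    intro r hr
    have hd : deriv (fun ρ => u ρ 0 ^ m) r = deriv (fun ρ => v ρ 0) r := by
      apply EventuallyEq.deriv_eq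
      filter_upwards [Ioi_mem_nhds (mem_Ioi.1 hr)] with ρ hρ
      rw [h.veq, hUe ρ (le_of_lt hρ) 0 ⟨le_rfl, hT.le⟩]
    simp only [hd, Sol.ff]
    rw [hUe r (le_of_lt hr) 0 ⟨le_rfl, hT.le⟩, e2]
    simp only [Sw]
    field_simp
  -- dissipation
  have hQ : (∫ σ in Set.Ioc (0:ℝ) τ, ∫ s in Set.Ioi (0:ℝ),
            rescaled m T u s σ ^ (m - 1) *
              (deriv (fun σ' => rescaled m T u s σ') σ) ^ 2 *
              Real.sinh s ^ (N - 1))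
      = ∫ t in Ioc 0 b, Sol.la m T t * ∫ r in Ioi (0:ℝ), Sol.qq N m T U ut t r := by
    have hmono : StrictMono θ := by
      intro x y hxy
      have : Real.exp (-y / T) < Real.exp (-x / T) := by
        apply Real.exp_lt_exp.2
        exact div_lt_div_of_pos_right (by linarith) hT
      simp only [hθ]; nlinarith
    have hcont : Continuous θ := continuous_iff_continuousAt.2 fun x => (hθd x).continuousAt
    have θ0 : θ 0 = 0 := by simp [hθ]
    have himg : θ '' Ioc 0 τ = Ioc 0 b := by
      ext t
      constructor
      · rintro ⟨σ, hσ, rfl⟩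
        exact ⟨(hθm σ hσ.1).1, hmono.monotone hσ.2⟩
      · intro ht
        have := intermediate_value_Icc hτ.le hcont.continuousOn (show t ∈ Icc (θ 0) (θ τ) from ⟨by rw [θ0]; exact ht.1.le, ht.2⟩)
        obtain ⟨σ, hσ, rfl⟩ := this
        refine ⟨σ, ⟨?_, hσ.2⟩, rfl⟩
        rcases hσ.1.eq_or_lt with h0 | h0
        · rw [← h0, θ0] at ht; exact absurd ht.1 (lt_irrefl _)
        · exact h0
    rw [← himg, integral_image_eq_integral_abs_deriv_smul measurableSet_Ioc
      (fun x _ => (hθd x).hasDerivWithinAt) hmono.injective.injOn]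
    apply setIntegral_congr_fun measurableSet_Ioc
    intro σ hσ
    have hσ0 := hσ.1
    have ht := hθm σ hσ0
    simp only [smul_eq_mul]
    rw [abs_of_pos (Real.exp_pos _), ← mul_assoc, ← integral_const_mul]
    apply setIntegral_congr_fun measurableSet_Ioi
    intro r hr
    have hr0 : 0 ≤ r := le_of_lt hr
    have hd : HasDerivAt (fun σ' => rescaled m T u r σ')
        (Real.exp (σ / ((1 - m) * T)) * (1 / ((1 - m) * T)) * U r (θ σ)
          + Real.exp (σ / ((1 - m) * T)) * (ut r (θ σ) * Real.exp (-σ / T))) σ := by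
      have d1 : HasDerivAt (fun σ : ℝ => Real.exp (σ / ((1 - m) * T))) (Real.exp (σ / ((1 - m) * T)) * (1 / ((1 - m) * T))) σ :=
        ((hasDerivAt_id σ).div_const _).exp
      have d2 : HasDerivAt (fun σ => U r (θ σ)) (ut r (θ σ) * Real.exp (-σ / T)) σ :=
        (h.du r hr0 _ ht).comp σ (hθd σ)
      refine (d1.mul d2).congr_of_eventuallyEq ?_
      filter_upwards [Ioi_mem_nhds hσ0] with x hx
      show Real.exp (x / ((1 - m) * T)) * u r (θ x) = Real.exp (x / ((1 - m) * T)) * U r (θ x)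
      rw [hUe r hr0 _ (Ioo_subset_Icc_self (hθm x hx))]
    simp only [hd.deriv, Sol.qq]
    rw [hw r σ (m - 1) hr0 hσ0, hla, hθT]
    have x1 : Real.exp (σ / ((1 - m) * T) * (m - 1)) * Real.exp (σ / ((1 - m) * T)) ^ 2 * Real.exp (-σ / T) 
        = Real.exp (2 * m / (1 - m) * (σ / T)) := by
      rw [← Real.exp_nat_mul, ← Real.exp_add, ← Real.exp_add]; congr 1; push_cast; field_simp; ring
    rw [← x1]
    have := (Real.exp_pos (-σ / T)).ne'
    simp only [Sw]
    generalize Real.exp (-σ / T) = y at *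
    field_simp
    ring
  rw [hL, hR, hQ]
  exact hmain
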